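/- arXiv:2503.09115 — 5 statements merged into one kernel-verified Lean document; each statement's English description precedes it below -/
import Mathlib

section
/- Let G be a cyclically-ordered graph on Fin n and let k be a positive integer with k ≤ (n−1)/2. If G does not contain k+1 pairwise crossing edges, then G has at most 2kn − (2k+1 choose 2) edges. -/
/-- A list of elements of `Fin n` appears in the natural cyclic order of `Fin n` if
there is some rotation of `Fin n` under which the list is strictly increasing. -/
def FinCyclicSorted {n : ℕ} (l : List (Fin n)) : Prop :=
  ∃ r : Fin n, (l.map (fun x => x - r)).Chain' (· < ·)

/-- Two edges of a cyclically-ordered graph on `Fin n` cross if their endpoints are four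
distinct vertices `a, c, b, d` appearing in this cyclic order such that the two edges are
`{a,b}` and `{c,d}`. -/
def CrossEdges {n : ℕ} (e f : Sym2 (Fin n)) : Prop :=
  ∃ a b c d : Fin n, e = s(a, b) ∧ f = s(c, d) ∧ FinCyclicSorted [a, c, b, d]

namespace CP
open Finset

def X (p q : ℕ × ℕ) : Prop :=
  (p.1 < q.1 ∧ q.1 < p.2 ∧ p.2 < q.2) ∨ (q.1 < p.1 ∧ p.1 < q.2 ∧ q.2 < p.2)

def PW (C : Finset (ℕ × ℕ)) : Prop := ∀ p ∈ C, ∀ q ∈ C, p ≠ q → X p q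

def Lg (n k : ℕ) (p : ℕ × ℕ) : Prop := p.1 + k + 1 ≤ p.2 ∧ p.2 + k + 1 ≤ p.1 + n ∧ p.2 < n

def LT (p q : ℕ × ℕ) : Prop := p.1 < q.1 ∧ p.2 < q.2

def CH (C : Finset (ℕ × ℕ)) : Prop := ∀ p ∈ C, ∀ q ∈ C, p ≠ q → LT p q ∨ LT q p

/-- antichain projection bound -/
lemma anti_card (S : Finset (ℕ × ℕ)) (hne : S.Nonempty)
    (h : ∀ p ∈ S, ∀ q ∈ S, ¬ LT p q) :
    S.card + 1 ≤ (S.image Prod.fst).card + (S.image Prod.snd).card := by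
  induction hn : S.card generalizing S with
  | zero => simp at hn; simp [hn] at hne
  | succ c ih =>
    obtain ⟨p, hp, hmax⟩ := S.exists_max_image (fun p => (p.1 : ℤ) - p.2) hne
    have hc : (S.erase p).card = c := by rw [card_erase_of_mem hp]; omega
    by_cases hS : (S.erase p).Nonempty
    · have ih' := ih (S.erase p) hS
        (fun a ha b hb => h a (mem_of_mem_erase ha) b (mem_of_mem_erase hb)) hc
      have s1 : (S.erase p).image Prod.fst ⊆ S.image Prod.fst :=
        image_subset_image (erase_subset _ _)
      have s2 : (S.erase p).image Prod.snd ⊆ S.image Prod.snd :=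
        image_subset_image (erase_subset _ _)
      have key : p.1 ∉ (S.erase p).image Prod.fst ∨ p.2 ∉ (S.erase p).image Prod.snd := by
        by_contra hcon
        push Not at hcon
        simp only [mem_image, mem_erase] at hcon
        obtain ⟨⟨q, ⟨hqp, hq⟩, e1⟩, ⟨r, ⟨hrp, hr⟩, e2⟩⟩ := hcon
        have m1 := hmax q hq
        have m2 := hmax r hr
        apply h r hr q hq
        have n1 : q.2 ≠ p.2 := fun e => hqp (Prod.ext e1 e)
        have n2 : r.1 ≠ p.1 := fun e => hrp (Prod.ext e e2)
        unfold LT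
        omega
      rcases key with key | key
      · have : ((S.erase p).image Prod.fst).card < (S.image Prod.fst).card :=
          card_lt_card ⟨s1, fun hh => key (hh (mem_image_of_mem _ hp))⟩
        have := card_le_card s2
        omega
      · have : ((S.erase p).image Prod.snd).card < (S.image Prod.snd).card :=
          card_lt_card ⟨s2, fun hh => key (hh (mem_image_of_mem _ hp))⟩
        have := card_le_card s1
        omega
    · rw [not_nonempty_iff_eq_empty] at hS
      rw [hS] at hc
      simp at hc
      have a1 : 0 < (S.image Prod.fst).card := card_pos.mpr (hne.image _)
      have a2 : 0 < (S.image Prod.snd).card := card_pos.mpr (hne.image _)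
      omega

lemma box_card (S : Finset (ℕ × ℕ)) (a0 a1 b0 b1 : ℕ) (hb : b0 < b1) (ha : a0 ≤ a1)
    (h : ∀ p ∈ S, ∀ q ∈ S, ¬ LT p q)
    (hbox : ∀ p ∈ S, a0 ≤ p.1 ∧ p.1 ≤ a1 ∧ b0 ≤ p.2 ∧ p.2 ≤ b1)
    (h0 : (a0, b1) ∉ S) (h1 : (a1, b0) ∉ S) :
    S.card ≤ ((S.image Prod.fst).filter (fun a => a0 < a ∧ a < a1)).card
      + ((S.image Prod.snd).filter (fun b => b0 < b ∧ b < b1)).card + 1 := by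
  have hA : ∀ p ∈ insert (a0, b1) (insert (a1, b0) S),
      ∀ q ∈ insert (a0, b1) (insert (a1, b0) S), ¬ LT p q := by
    intro p hp q hq
    simp only [mem_insert] at hp hq
    unfold LT
    rcases hp with rfl | rfl | hp <;> rcases hq with rfl | rfl | hq <;> (try simp only) <;>
      first
      | omega
      | (have := hbox q hq; omega)
      | (have := hbox p hp; omega)
      | exact h p hp q hq
  have := anti_card _ (insert_nonempty _ _) hA
  rw [card_insert_of_notMem, card_insert_of_notMem h1] at this
  · have e1 : (insert (a0, b1) (insert (a1, b0) S)).image Prod.fst ⊆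
        ((S.image Prod.fst).filter (fun a => a0 < a ∧ a < a1)) ∪ {a0, a1} := by
      intro a ha
      simp only [mem_image, mem_insert, mem_union, mem_filter, mem_singleton] at ha ⊢
      obtain ⟨p, hp, rfl⟩ := ha
      rcases hp with rfl | rfl | hp
      · simp
      · simp
      · have := hbox p hp
        by_cases c1 : p.1 = a0
        · tauto
        by_cases c2 : p.1 = a1
        · tauto
        left
        exact ⟨⟨p, hp, rfl⟩, by omega, by omega⟩
    have e2 : (insert (a0, b1) (insert (a1, b0) S)).image Prod.snd ⊆
        ((S.image Prod.snd).filter (fun b => b0 < b ∧ b < b1)) ∪ {b0, b1} := by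
      intro a ha
      simp only [mem_image, mem_insert, mem_union, mem_filter, mem_singleton] at ha ⊢
      obtain ⟨p, hp, rfl⟩ := ha
      rcases hp with rfl | rfl | hp
      · simp
      · simp
      · have := hbox p hp
        by_cases c1 : p.2 = b0
        · tauto
        by_cases c2 : p.2 = b1
        · tauto
        left
        exact ⟨⟨p, hp, rfl⟩, by omega, by omega⟩
    have l1 := (card_le_card e1).trans (card_union_le _ _)
    have l2 := (card_le_card e2).trans (card_union_le _ _)
    have := card_le_two (a := a0) (b := a1)
    have := card_le_two (a := b0) (b := b1)
    omega
  · simp only [mem_insert, not_or]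
    refine ⟨?_, h0⟩
    intro e
    simp only [Prod.mk.injEq] at e
    omega

/-- level function -/
def lev (T : Finset (ℕ × ℕ)) (p : ℕ × ℕ) : ℕ :=
  1 + (T.filter (fun q => q.1 < p.1 ∧ q.2 < p.2)).attach.sup (fun q => lev T q.1)
termination_by p.1
decreasing_by
  have := q.2
  simp only [mem_filter] at this
  exact this.2.1

lemma lev_pos (T p) : 1 ≤ lev T p := by rw [lev]; omega

lemma lev_lt {T : Finset (ℕ × ℕ)} {p q : ℕ × ℕ} (hp : p ∈ T) (h : LT p q) :
    lev T p < lev T q := by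
  rw [lev.eq_1 T q]
  have hm : p ∈ T.filter (fun r => r.1 < q.1 ∧ r.2 < q.2) := by
    rw [mem_filter]; exact ⟨hp, h⟩
  have := Finset.le_sup (f := fun q : {x // x ∈ T.filter (fun r => r.1 < q.1 ∧ r.2 < q.2)} => lev T q.1) (mem_attach _ ⟨p, hm⟩)
  simp only at this
  omega

lemma lev_pred {T : Finset (ℕ × ℕ)} {p : ℕ × ℕ} (h : 2 ≤ lev T p) :
    ∃ q ∈ T, LT q p ∧ lev T q + 1 = lev T p := by
  have e := lev.eq_1 T p
  by_cases hne : (T.filter (fun q => q.1 < p.1 ∧ q.2 < p.2)).attach.Nonempty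
  · obtain ⟨q, -, hq⟩ := Finset.exists_mem_eq_sup _ hne
      (fun q : {x // x ∈ T.filter (fun r => r.1 < p.1 ∧ r.2 < p.2)} => lev T q.1)
    have h2 := q.2
    rw [mem_filter] at h2
    refine ⟨q.1, h2.1, h2.2, ?_⟩
    rw [e, hq]; omega
  · rw [not_nonempty_iff_eq_empty] at hne
    rw [hne] at e
    simp at e
    omega

lemma LT.tr {p q r : ℕ × ℕ} (h : LT p q) (h' : LT q r) : LT p r :=
  ⟨h.1.trans h'.1, h.2.trans h'.2⟩

lemma lev_pred' {T : Finset (ℕ × ℕ)} {p : ℕ × ℕ} {j : ℕ} (h1 : 1 ≤ j) (h : j < lev T p) :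
    ∃ q ∈ T, LT q p ∧ lev T q = j := by
  induction hd : lev T p generalizing p with
  | zero => omega
  | succ d ih =>
    obtain ⟨q, hq, hl, he⟩ := lev_pred (T := T) (p := p) (by omega)
    by_cases hj : lev T q = j
    · exact ⟨q, hq, hl, hj⟩
    · obtain ⟨r, hr, hrl, hre⟩ := ih (p := q) (by omega) (by omega)
      exact ⟨r, hr, hrl.tr hl, hre⟩

lemma lev_chain {T : Finset (ℕ × ℕ)} {p : ℕ × ℕ} (hp : p ∈ T) :
    ∃ C ⊆ T, C.card = lev T p ∧ CH C ∧ ∀ q ∈ C, q = p ∨ LT q p := by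
  induction hd : lev T p generalizing p with
  | zero => have := lev_pos T p; omega
  | succ d ih =>
    by_cases h2 : 2 ≤ lev T p
    · obtain ⟨q, hq, hl, he⟩ := lev_pred h2
      obtain ⟨C, hC, hcard, hch, hle⟩ := ih hq (by omega)
      have hlt : ∀ r ∈ C, LT r p := by
        intro r hr
        rcases hle r hr with rfl | h
        · exact hl
        · exact h.tr hl
      refine ⟨insert p C, insert_subset hp hC, ?_, ?_, ?_⟩
      · rw [card_insert_of_notMem, hcard]
        intro h
        exact lt_irrefl _ (hlt p h).1
      · intro a ha b hb hab
        rw [mem_insert] at ha hb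
        rcases ha with rfl | ha <;> rcases hb with rfl | hb
        · exact absurd rfl hab
        · exact Or.inr (hlt _ hb)
        · exact Or.inl (hlt _ ha)
        · exact hch a ha b hb hab
      · intro r hr
        rw [mem_insert] at hr
        exact hr.imp id (hlt r)
    · have := lev_pos T p
      refine ⟨{p}, by simpa using hp, by simp; omega, ?_, by simp⟩
      intro a ha b hb hab
      simp at ha hb
      exact absurd (ha.trans hb.symm) hab

/-- lifting lemma -/
lemma lift_aux (T : Finset (ℕ × ℕ)) (lv : ℕ × ℕ → ℕ)
    (H1 : ∀ p ∈ T, ∀ q ∈ T, LT p q → lv p < lv q)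
    (H2 : ∀ p ∈ T, ∀ j, 1 ≤ j → j < lv p → ∃ q ∈ T, LT q p ∧ lv q = j)
    (N : ℕ) : ∀ Z : Finset (ℕ × ℕ), Z.card = N → CH Z →
    (∀ z ∈ Z, 1 ≤ z.2 ∧ ∃ b, (z.1, b) ∈ T ∧ lv (z.1, b) = z.2) →
    ∀ z ∈ Z, (∀ w ∈ Z, w ≠ z → LT w z) →
    ∀ c ∈ T, lv c = z.2 → z.1 ≤ c.1 →
    ∃ C ⊆ T, C.card = N ∧ CH C ∧ (∀ x ∈ C, x = c ∨ LT x c) ∧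
      ∀ x ∈ C, ∃ w ∈ Z, w.1 ≤ x.1 := by
  induction N with
  | zero =>
    intro Z hZ _ _ z hz
    rw [card_eq_zero] at hZ
    simp [hZ] at hz
  | succ N ih =>
    intro Z hZ hch hex z hz htop c hc hlc hzc
    by_cases hne : (Z.erase z).Nonempty
    · obtain ⟨w, hw, hwmax⟩ := (Z.erase z).exists_max_image Prod.snd hne
      have hwZ := mem_of_mem_erase hw
      have hwz := htop w hwZ (ne_of_mem_erase hw)
      obtain ⟨hw1, b, hbT, hbl⟩ := hex w hwZ
      have hc' : ∃ c' ∈ T, LT c' c ∧ lv c' = w.2 ∧ w.1 ≤ c'.1 := by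
        obtain ⟨d, hd, hdc, hdl⟩ := H2 c hc w.2 hw1 (by rw [hlc]; exact hwz.2)
        by_cases hdw : w.1 ≤ d.1
        · exact ⟨d, hd, hdc, hdl, hdw⟩
        · refine ⟨(w.1, b), hbT, ⟨lt_of_lt_of_le hwz.1 hzc, ?_⟩, hbl, le_refl _⟩
          by_contra hcon
          have : lv d < lv (w.1, b) := by
            apply H1 d hd _ hbT
            have := hdc.2
            unfold LT
            simp only at hcon ⊢
            omega
          omega
      obtain ⟨c', hc'T, hc'c, hc'l, hc'w⟩ := hc'
      obtain ⟨C, hCT, hcard, hCH, hCle, hCw⟩ := ih (Z.erase z)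
        (by rw [card_erase_of_mem hz]; omega)
        (fun a ha b hb => hch a (mem_of_mem_erase ha) b (mem_of_mem_erase hb))
        (fun a ha => hex a (mem_of_mem_erase ha)) w hw
        (fun v hv hvw => by
          rcases hch v (mem_of_mem_erase hv) w hwZ hvw with h | h
          · exact h
          · have := hwmax v hv
            have := h.2
            omega) c' hc'T hc'l hc'w
      have hlt : ∀ r ∈ C, LT r c := by
        intro r hr
        rcases hCle r hr with rfl | h
        · exact hc'c
        · exact h.tr hc'c
      refine ⟨insert c C, insert_subset hc hCT, ?_, ?_, ?_, ?_⟩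
      · rw [card_insert_of_notMem, hcard]
        intro h
        exact lt_irrefl _ (hlt c h).1
      · intro a ha b hb hab
        rw [mem_insert] at ha hb
        rcases ha with rfl | ha <;> rcases hb with rfl | hb
        · exact absurd rfl hab
        · exact Or.inr (hlt _ hb)
        · exact Or.inl (hlt _ ha)
        · exact hCH a ha b hb hab
      · intro r hr
        rw [mem_insert] at hr
        exact hr.imp id (hlt r)
      · intro r hr
        rw [mem_insert] at hr
        rcases hr with rfl | hr
        · exact ⟨z, hz, hzc⟩
        · obtain ⟨v, hv, h⟩ := hCw r hr
          exact ⟨v, mem_of_mem_erase hv, h⟩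
    · rw [not_nonempty_iff_eq_empty] at hne
      have hcd := card_erase_of_mem hz
      rw [hne, card_empty] at hcd
      refine ⟨{c}, by simpa using hc, by rw [card_singleton]; omega, ?_, by simp, ?_⟩
      · intro a ha b hb hab
        simp at ha hb
        exact absurd (ha.trans hb.symm) hab
      · intro x hx
        rw [mem_singleton] at hx
        exact ⟨z, hz, hx ▸ hzc⟩

lemma lift (T : Finset (ℕ × ℕ)) (lv : ℕ × ℕ → ℕ)
    (H1 : ∀ p ∈ T, ∀ q ∈ T, LT p q → lv p < lv q)
    (H2 : ∀ p ∈ T, ∀ j, 1 ≤ j → j < lv p → ∃ q ∈ T, LT q p ∧ lv q = j)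
    (Z : Finset (ℕ × ℕ)) (hch : CH Z)
    (hex : ∀ z ∈ Z, 1 ≤ z.2 ∧ ∃ b, (z.1, b) ∈ T ∧ lv (z.1, b) = z.2) :
    ∃ C ⊆ T, C.card = Z.card ∧ CH C ∧
      ∀ x ∈ C, ∃ w ∈ Z, ∃ z ∈ Z, w.1 ≤ x.1 ∧ x.1 ≤ z.1 := by
  by_cases hne : Z.Nonempty
  · obtain ⟨z, hz, hmax⟩ := Z.exists_max_image Prod.snd hne
    obtain ⟨-, b, hb, hl⟩ := hex z hz
    obtain ⟨C, h1, h2, h3, h4, h5⟩ := lift_aux T lv H1 H2 Z.card Z rfl hch hex z hz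
      (fun v hv hvw => by
          rcases hch v hv z hz hvw with h | h
          · exact h
          · have := hmax v hv
            have := h.2
            omega) _ hb hl (le_refl _)
    refine ⟨C, h1, h2, h3, fun x hx => ?_⟩
    obtain ⟨w, hw, h⟩ := h5 x hx
    refine ⟨w, hw, z, hz, h, ?_⟩
    rcases h4 x hx with rfl | h
    · exact le_refl _
    · exact h.1.le
  · rw [not_nonempty_iff_eq_empty] at hne
    subst hne
    exact ⟨∅, by simp, by simp, by simp [CH], by simp⟩

/-- short pairs -/
def Sh (n k : ℕ) : Finset (ℕ × ℕ) :=
  (range n ×ˢ range n).filter (fun p => p.1 < p.2 ∧ (p.2 ≤ p.1 + k ∨ p.1 + n ≤ p.2 + k))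

lemma mem_Sh {n k : ℕ} {p : ℕ × ℕ} :
    p ∈ Sh n k ↔ p.1 < p.2 ∧ p.2 < n ∧ (p.2 ≤ p.1 + k ∨ p.1 + n ≤ p.2 + k) := by
  simp only [Sh, mem_filter, mem_product, mem_range]
  constructor
  · rintro ⟨⟨_, _⟩, _, _⟩; omega
  · rintro ⟨_, _, _⟩; omega

lemma Sh_card (n k : ℕ) : (Sh n k).card ≤ n * k := by
  have : (range n ×ˢ Icc 1 k).card = n * k := by simp
  rw [← this]
  apply card_le_card_of_injOn (fun p => if p.2 ≤ p.1 + k then (p.1, p.2 - p.1) else (p.2, p.1 + n - p.2))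
  · intro p hp
    have := mem_Sh.1 hp
    simp only [coe_product, Set.mem_prod, mem_coe, mem_range, mem_Icc]
    split_ifs <;> simp only <;> omega
  · intro p hp q hq h
    have := mem_Sh.1 hp
    have := mem_Sh.1 hq
    simp only at h
    split_ifs at h <;> simp only [Prod.mk.injEq] at h <;> apply Prod.ext <;> omega

lemma add_short (n k : ℕ) (E : Finset (ℕ × ℕ)) (hn : ∀ p ∈ E, p.2 < n)
    (hE : ∀ C ⊆ E, C.card = k + 1 → ¬ PW C) :
    ∀ C ⊆ E ∪ Sh n k, C.card = k + 1 → ¬ PW C := by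
  intro C hC hcard hpw
  by_cases hs : ∃ p ∈ C, p ∈ Sh n k
  · obtain ⟨p, hpC, hpS⟩ := hs
    have hp := mem_Sh.1 hpS
    have hn' : ∀ q ∈ C, q.2 < n := by
      intro q hq
      rcases mem_union.1 (hC hq) with h | h
      · exact hn q h
      · exact (mem_Sh.1 h).2.1
    have hcd := card_erase_of_mem hpC
    have hX : ∀ q ∈ C.erase p, X p q := fun q hq =>
      hpw p hpC q (mem_of_mem_erase hq) (ne_of_mem_erase hq).symm
    have hXX : ∀ q ∈ C.erase p, ∀ r ∈ C.erase p, q ≠ r → X q r := fun q hq r hr hne =>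
      hpw q (mem_of_mem_erase hq) r (mem_of_mem_erase hr) hne
    rcases hp.2.2 with h | h
    · have : (C.erase p).card ≤ (Ioo p.1 p.2).card := by
        apply card_le_card_of_injOn (fun q => if p.1 < q.1 then q.1 else q.2)
        · intro q hq
          have := hX q hq
          unfold X at this
          simp only [coe_Ioo, Set.mem_Ioo]
          split_ifs <;> omega
        · intro q hq r hr he
          by_contra hne
          have h1 := hX q hq
          have h2 := hX r hr
          have h3 := hXX q hq r hr hne
          unfold X at h1 h2 h3
          simp only at he
          split_ifs at he <;> omega
      rw [Nat.card_Ioo] at this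
      omega
    · have : (C.erase p).card ≤ (range p.1 ∪ Ioo p.2 n).card := by
        apply card_le_card_of_injOn (fun q => if p.1 < q.1 then q.2 else q.1)
        · intro q hq
          have := hX q hq
          have := hn' q (mem_of_mem_erase hq)
          unfold X at *
          simp only [mem_coe, mem_union, mem_range, mem_Ioo]
          split_ifs <;> omega
        · intro q hq r hr he
          by_contra hne
          have h1 := hX q hq
          have h2 := hX r hr
          have h3 := hXX q hq r hr hne
          unfold X at h1 h2 h3
          simp only at he
          split_ifs at he <;> omega
      have h2 := card_union_le (range p.1) (Ioo p.2 n)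
      rw [Nat.card_Ioo, card_range] at h2
      omega
  · push Not at hs
    exact hE C (fun q hq => (mem_union.1 (hC hq)).resolve_right (hs q hq)) hcard hpw


/-- bound for a long-edge graph -/
def Good (n k : ℕ) : Prop := ∀ E : Finset (ℕ × ℕ), (∀ p ∈ E, Lg n k p) →
  (∀ C ⊆ E, C.card = k + 1 → ¬ PW C) → E.card ≤ k * (n - (2 * k + 1))

/-- cells crossing the chord (0,m) -/
def TT (n k m : ℕ) (E : Finset (ℕ × ℕ)) : Finset (ℕ × ℕ) :=
  (E ∪ Sh n k).filter (fun p => 1 ≤ p.1 ∧ p.1 < m ∧ m < p.2)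

section step
variable {n k m : ℕ} {E : Finset (ℕ × ℕ)}

lemma mem_TT {p : ℕ × ℕ} : p ∈ TT n k m E ↔ p ∈ E ∪ Sh n k ∧ 1 ≤ p.1 ∧ p.1 < m ∧ m < p.2 := by
  simp only [TT, mem_filter]

lemma TT_n (hL : ∀ p ∈ E, Lg n k p) {p : ℕ × ℕ} (hp : p ∈ E ∪ Sh n k) : p.2 < n := by
  rcases mem_union.1 hp with h | h
  · exact (hL p h).2.2
  · exact (mem_Sh.1 h).2.1

lemma PW_of_CH {C : Finset (ℕ × ℕ)} (hC : C ⊆ TT n k m E) (h : CH C) : PW C := by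
  intro p hp q hq hne
  have h1 := (mem_TT.1 (hC hp)).2
  have h2 := (mem_TT.1 (hC hq)).2
  have h3 := h p hp q hq hne
  unfold LT at h3
  unfold X
  omega

lemma lev_le (hL : ∀ p ∈ E, Lg n k p) (hE : ∀ C ⊆ E, C.card = k + 1 → ¬ PW C)
    (hm : (0, m) ∈ E) {p : ℕ × ℕ} (hp : p ∈ TT n k m E) : lev (TT n k m E) p + 1 ≤ k := by
  by_contra hcon
  obtain ⟨C, hC, hcard, hCH, -⟩ := lev_chain hp
  obtain ⟨D, hDC, hD⟩ := exists_subset_card_eq (s := C) (n := k) (by omega)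
  have hD0 : ∀ q ∈ D, 1 ≤ q.1 ∧ q.1 < m ∧ m < q.2 := fun q hq => (mem_TT.1 (hC (hDC hq))).2
  have hDp : PW D := PW_of_CH (hDC.trans hC) (fun a ha b hb => hCH a (hDC ha) b (hDC hb))
  refine add_short n k E (fun p hp => (hL p hp).2.2) hE (insert (0, m) D) ?_ ?_ ?_
  · apply insert_subset (mem_union_left _ hm)
    intro q hq
    exact (mem_TT.1 (hC (hDC hq))).1
  · rw [card_insert_of_notMem, hD]
    intro h
    have := (hD0 _ h).1
    simp at this
  · intro a ha b hb hab
    rw [mem_insert] at ha hb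
    rcases ha with rfl | ha <;> rcases hb with rfl | hb
    · exact absurd rfl hab
    · have := hD0 _ hb
      unfold X; simp only; omega
    · have := hD0 _ ha
      unfold X; simp only; omega
    · exact hDp a ha b hb hab

lemma lev_lower {p : ℕ × ℕ} (hp : p ∈ TT n k m E) :
    lev (TT n k m E) p ≤ p.1 ∧ m + lev (TT n k m E) p ≤ p.2 := by
  induction hd : lev (TT n k m E) p generalizing p with
  | zero => have := lev_pos (TT n k m E) p; omega
  | succ d ih =>
    have h := (mem_TT.1 hp).2
    by_cases h2 : 2 ≤ lev (TT n k m E) p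
    · obtain ⟨q, hq, hl, he⟩ := lev_pred h2
      have := ih hq (by omega)
      unfold LT at hl
      omega
    · omega

lemma lev_cornerX (hm1 : k + 1 ≤ m) (hm2 : m + k + 1 ≤ n) (j : ℕ) (h1 : 1 ≤ j) (h2 : j + 1 ≤ k) :
    (j, n - k + j) ∈ TT n k m E ∧ j ≤ lev (TT n k m E) (j, n - k + j) := by
  have hmem : ∀ j, 1 ≤ j → j + 1 ≤ k → (j, n - k + j) ∈ TT n k m E := by
    intro j h1 h2
    rw [mem_TT, mem_union, mem_Sh]
    simp only
    refine ⟨Or.inr ?_, ?_⟩ <;> omega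
  refine ⟨hmem j h1 h2, ?_⟩
  induction j, h1 using Nat.le_induction with
  | base => exact lev_pos _ _
  | succ j h ih =>
    have := ih (by omega)
    have := lev_lt (q := (j + 1, n - k + (j + 1))) (hmem j h (by omega))
      (by unfold LT; simp only; omega)
    omega

lemma lev_cornerY (hm1 : k + 1 ≤ m) (hm2 : m + k + 1 ≤ n) (j : ℕ) (h1 : 1 ≤ j) (h2 : j + 1 ≤ k) :
    (m - k + j, m + j) ∈ TT n k m E ∧ j ≤ lev (TT n k m E) (m - k + j, m + j) := by
  have hmem : ∀ j, 1 ≤ j → j + 1 ≤ k → (m - k + j, m + j) ∈ TT n k m E := by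
    intro j h1 h2
    rw [mem_TT, mem_union, mem_Sh]
    simp only
    refine ⟨Or.inr ?_, ?_⟩ <;> omega
  refine ⟨hmem j h1 h2, ?_⟩
  induction j, h1 using Nat.le_induction with
  | base => exact lev_pos _ _
  | succ j h ih =>
    have := ih (by omega)
    have := lev_lt (q := (m - k + (j + 1), m + (j + 1))) (hmem j h (by omega))
      (by unfold LT; simp only; omega)
    omega

lemma lev_upper (hm1 : k + 1 ≤ m) (hm2 : m + k + 1 ≤ n) (hL : ∀ p ∈ E, Lg n k p)
    (hE : ∀ C ⊆ E, C.card = k + 1 → ¬ PW C)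
    (hm : (0, m) ∈ E)
    {p : ℕ × ℕ} (hp : p ∈ TT n k m E) (hpE : p ∈ E) :
    p.1 ≤ m - k + lev (TT n k m E) p ∧ p.2 ≤ n - k + lev (TT n k m E) p := by
  have hl := hL p hpE
  have h0 := mem_TT.1 hp
  have hp1 := lev_pos (TT n k m E) p
  have hle := lev_le hL hE hm hp
  unfold Lg at hl
  constructor
  · by_contra hcon
    obtain ⟨hc, hcl⟩ := lev_cornerY (E := E) hm1 hm2 (lev (TT n k m E) p) hp1 hle
    have := lev_lt (q := p) hc (by unfold LT; simp only; omega)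
    omega
  · by_contra hcon
    obtain ⟨hc, hcl⟩ := lev_cornerX (E := E) hm1 hm2 (lev (TT n k m E) p) hp1 hle
    have := lev_lt (q := p) hc (by unfold LT; simp only; omega)
    omega

/-- long crossing cells of level i -/
def AA (n k m : ℕ) (E : Finset (ℕ × ℕ)) (i : ℕ) : Finset (ℕ × ℕ) :=
  E.filter (fun p => (1 ≤ p.1 ∧ p.1 < m ∧ m < p.2) ∧ lev (TT n k m E) p = i)

lemma AA_TT {i : ℕ} {p : ℕ × ℕ} (h : p ∈ AA n k m E i) :
    p ∈ TT n k m E ∧ p ∈ E ∧ lev (TT n k m E) p = i := by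
  simp only [AA, mem_filter] at h
  exact ⟨mem_TT.2 ⟨mem_union_left _ h.1, h.2.1⟩, h.1, h.2.2⟩

def P1 (n k m : ℕ) (E : Finset (ℕ × ℕ)) (i : ℕ) : Finset ℕ :=
  ((AA n k m E i).image Prod.fst).filter (fun a => i < a ∧ a < m - k + i)

def P2 (n k m : ℕ) (E : Finset (ℕ × ℕ)) (i : ℕ) : Finset ℕ :=
  ((AA n k m E i).image Prod.snd).filter (fun b => m + i < b ∧ b < n - k + i)

lemma AA_card (hm1 : k + 1 ≤ m) (hm2 : m + k + 1 ≤ n) (hL : ∀ p ∈ E, Lg n k p)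
    (hE : ∀ C ⊆ E, C.card = k + 1 → ¬ PW C)
    (hm : (0, m) ∈ E) (i : ℕ) :
    (AA n k m E i).card ≤ (P1 n k m E i).card + (P2 n k m E i).card + 1 := by
  apply box_card
  · omega
  · omega
  · intro p hp q hq h
    have h1 := AA_TT hp
    have h2 := AA_TT hq
    have := lev_lt h1.1 h
    omega
  · intro p hp
    have h1 := AA_TT hp
    have h2 := lev_lower h1.1
    have h3 := lev_upper hm1 hm2 hL hE hm h1.1 h1.2.1
    omega
  · intro h
    have := hL _ (AA_TT h).2.1
    unfold Lg at this
    simp only at this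
    omega
  · intro h
    have := hL _ (AA_TT h).2.1
    unfold Lg at this
    simp only at this
    omega

def W1 (n k m : ℕ) (E : Finset (ℕ × ℕ)) : Finset (ℕ × ℕ) :=
  (Icc 1 (k - 1)).biUnion (fun i => (P1 n k m E i).image (fun a => (a, m + i)))

def W2 (n k m : ℕ) (E : Finset (ℕ × ℕ)) : Finset (ℕ × ℕ) :=
  (Icc 1 (k - 1)).biUnion (fun i => (P2 n k m E i).image (fun b => (i, b - m + k)))

lemma W1_card : (W1 n k m E).card = ∑ i ∈ Icc 1 (k - 1), (P1 n k m E i).card := by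
  unfold W1
  rw [card_biUnion]
  · apply sum_congr rfl
    intro i _
    apply card_image_of_injective
    intro a b h
    simpa using h
  · intro i _ j _ hij
    rw [Function.onFun, disjoint_left]
    intro p hp hq
    simp only [mem_image] at hp hq
    obtain ⟨a, -, rfl⟩ := hp
    obtain ⟨b, -, h⟩ := hq
    simp only [Prod.mk.injEq] at h
    omega

lemma W2_card : (W2 n k m E).card = ∑ i ∈ Icc 1 (k - 1), (P2 n k m E i).card := by
  unfold W2
  rw [card_biUnion]
  · apply sum_congr rfl
    intro i _
    apply card_image_of_injOn
    intro a ha b hb h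
    simp only [P2, mem_coe, mem_filter] at ha hb
    simp only [Prod.mk.injEq] at h
    omega
  · intro i _ j _ hij
    rw [Function.onFun, disjoint_left]
    intro p hp hq
    simp only [mem_image] at hp hq
    obtain ⟨a, -, rfl⟩ := hp
    obtain ⟨b, -, h⟩ := hq
    simp only [Prod.mk.injEq] at h
    omega

lemma mem_W1 {p : ℕ × ℕ} (h : p ∈ W1 n k m E) : ∃ i b, 1 ≤ i ∧ i + 1 ≤ k ∧ p.2 = m + i ∧
    i < p.1 ∧ p.1 < m - k + i ∧ (p.1, b) ∈ TT n k m E ∧ lev (TT n k m E) (p.1, b) = i := by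
  simp only [W1, mem_biUnion, mem_image, P1, mem_filter, mem_Icc] at h
  obtain ⟨i, hi, a, ⟨⟨q, hq, rfl⟩, h1, h2⟩, rfl⟩ := h
  have := AA_TT hq
  exact ⟨i, q.2, hi.1, by omega, rfl, h1, h2, this.1, this.2.2⟩

lemma mem_W2 {p : ℕ × ℕ} (h : p ∈ W2 n k m E) : ∃ a b, 1 ≤ p.1 ∧ p.1 + 1 ≤ k ∧ p.2 = b - m + k ∧
    m + p.1 < b ∧ b < n - k + p.1 ∧ (a, b) ∈ TT n k m E ∧ lev (TT n k m E) (a, b) = p.1 := by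
  simp only [W2, mem_biUnion, mem_image, P2, mem_filter, mem_Icc] at h
  obtain ⟨i, hi, a, ⟨⟨q, hq, rfl⟩, h1, h2⟩, rfl⟩ := h
  have := AA_TT hq
  exact ⟨q.1, q.2, hi.1, by simp only; omega, rfl, h1, h2, this.1, this.2.2⟩

def EA (m : ℕ) (E : Finset (ℕ × ℕ)) : Finset (ℕ × ℕ) :=
  E.filter (fun p => p.2 ≤ m ∧ p ≠ (0, m))

def EB (m : ℕ) (E : Finset (ℕ × ℕ)) : Finset (ℕ × ℕ) :=
  E.filter (fun p => m < p.2 ∧ (p.1 = 0 ∨ m ≤ p.1))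

def ph (m k : ℕ) (p : ℕ × ℕ) : ℕ × ℕ := (if p.1 = 0 then 0 else p.1 - m + k, p.2 - m + k)

lemma side1 (hk : 1 ≤ k) (hm1 : k + 1 ≤ m) (hm2 : m + k + 1 ≤ n) (hL : ∀ p ∈ E, Lg n k p)
    (hE : ∀ C ⊆ E, C.card = k + 1 → ¬ PW C) (hG : Good (m + k) k) :
    (EA m E).card + (W1 n k m E).card ≤ k * (m + k - (2 * k + 1)) := by
  have hd : Disjoint (EA m E) (W1 n k m E) := by
    rw [disjoint_left]
    intro p hp hq
    obtain ⟨i, b, h1, -, h2, -⟩ := mem_W1 hq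
    simp only [EA, mem_filter] at hp
    omega
  rw [← card_union_of_disjoint hd]
  apply hG
  · intro p hp
    rcases mem_union.1 hp with h | h
    · simp only [EA, mem_filter] at h
      have h1 := hL p h.1
      unfold Lg at h1 ⊢
      have h2 : p.1 ≠ 0 ∨ p.2 ≠ m := by
        by_contra hc
        push Not at hc
        exact h.2.2 (Prod.ext hc.1 hc.2)
      omega
    · obtain ⟨i, b, h⟩ := mem_W1 h
      unfold Lg
      omega
  · intro C hC hcard hpw
    set I := C.filter (fun p => p.2 ≤ m) with hI
    set W := C.filter (fun p => ¬ p.2 ≤ m) with hW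
    have hsum : I.card + W.card = k + 1 := by
      rw [← hcard]; exact card_filter_add_card_filter_not _
    have hIE : ∀ p ∈ I, p ∈ E ∧ p.2 ≤ m ∧ p ∈ C := by
      intro p hp
      rw [hI, mem_filter] at hp
      rcases mem_union.1 (hC hp.1) with h | h
      · simp only [EA, mem_filter] at h
        exact ⟨h.1, hp.2, hp.1⟩
      · obtain ⟨i, b, h⟩ := mem_W1 h
        omega
    have hWW : ∀ p ∈ W, p ∈ W1 n k m E ∧ m < p.2 ∧ p ∈ C := by
      intro p hp
      rw [hW, mem_filter] at hp
      rcases mem_union.1 (hC hp.1) with h | h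
      · simp only [EA, mem_filter] at h
        omega
      · exact ⟨h, by omega, hp.1⟩
    obtain ⟨D, hDT, hDc, hDch, hDw⟩ := lift (TT n k m E) (lev (TT n k m E))
      (fun p hp q _ h => lev_lt hp h) (fun p _ j h1 h2 => lev_pred' h1 h2)
      (W.image (fun p => (p.1, p.2 - m)))
      (by
        intro p hp q hq hne
        simp only [mem_image] at hp hq
        obtain ⟨p, hp, rfl⟩ := hp
        obtain ⟨q, hq, rfl⟩ := hq
        have hx := hpw p (hWW p hp).2.2 q (hWW q hq).2.2 (by rintro rfl; exact hne rfl)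
        obtain ⟨i, b, h⟩ := mem_W1 (hWW p hp).1
        obtain ⟨j, c, h'⟩ := mem_W1 (hWW q hq).1
        unfold X at hx
        unfold LT
        simp only
        omega)
      (by
        intro z hz
        simp only [mem_image] at hz
        obtain ⟨p, hp, rfl⟩ := hz
        obtain ⟨i, b, h⟩ := mem_W1 (hWW p hp).1
        have e : p.2 - m = i := by omega
        simp only [e]
        exact ⟨h.1, b, h.2.2.2.2.2⟩)
    rw [card_image_of_injOn] at hDc
    · have hdis : Disjoint I D := by
        rw [disjoint_left]
        intro p hp hq
        have := (hIE p hp).2.1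
        have := (mem_TT.1 (hDT hq)).2
        omega
      have hID : ∀ p ∈ I, ∀ q ∈ D, X p q ∧ X q p := by
        intro p hp q hq
        obtain ⟨w, hw, z, hz, h1, h2⟩ := hDw q hq
        simp only [mem_image] at hw hz
        obtain ⟨w, hw, rfl⟩ := hw
        obtain ⟨z, hz, rfl⟩ := hz
        have a1 := hIE p hp
        have a2 := hWW w hw
        have a3 := hWW z hz
        have x1 := hpw p a1.2.2 w a2.2.2 (by rintro rfl; omega)
        have x2 := hpw p a1.2.2 z a3.2.2 (by rintro rfl; omega)
        have a4 := (mem_TT.1 (hDT hq)).2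
        unfold X at x1 x2 ⊢
        simp only at h1 h2
        omega
      refine add_short n k E (fun p hp => (hL p hp).2.2) hE (I ∪ D) ?_ ?_ ?_
      · apply union_subset
        · intro p hp; exact mem_union_left _ (hIE p hp).1
        · intro p hp; exact (mem_TT.1 (hDT hp)).1
      · rw [card_union_of_disjoint hdis]; omega
      · intro p hp q hq hne
        rcases mem_union.1 hp with hp | hp <;> rcases mem_union.1 hq with hq | hq
        · exact hpw p (hIE p hp).2.2 q (hIE q hq).2.2 hne
        · exact (hID p hp q hq).1
        · exact (hID q hq p hp).2
        · exact PW_of_CH hDT hDch p hp q hq hne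
    · intro p hp q hq h
      have := hWW p hp
      have := hWW q hq
      simp only [Prod.mk.injEq] at h
      apply Prod.ext <;> omega

set_option maxHeartbeats 2000000 in
lemma side2 (hk : 1 ≤ k) (hm1 : k + 1 ≤ m) (hm2 : m + k + 1 ≤ n) (hL : ∀ p ∈ E, Lg n k p)
    (hE : ∀ C ⊆ E, C.card = k + 1 → ¬ PW C) (hG : Good (n - m + k) k) :
    (EB m E).card + (W2 n k m E).card ≤ k * (n - m + k - (2 * k + 1)) := by
  have hinj : Set.InjOn (ph m k) (EB m E) := by
    intro p hp q hq h
    simp only [EB, mem_coe, mem_filter] at hp hq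
    simp only [ph, Prod.mk.injEq] at h
    apply Prod.ext
    · split_ifs at h <;> omega
    · omega
  have hB : ∀ p ∈ (EB m E).image (ph m k), (p.1 = 0 ∨ k ≤ p.1) ∧ k < p.2 ∧ Lg (n - m + k) k p ∧
      (if p.1 = 0 then 0 else p.1 + m - k, p.2 + m - k) ∈ E := by
    intro p hp
    simp only [mem_image] at hp
    obtain ⟨q, hq, rfl⟩ := hp
    simp only [EB, mem_filter] at hq
    have h1 := hL q hq.1
    unfold Lg at h1 ⊢
    have e : (if (ph m k q).1 = 0 then 0 else (ph m k q).1 + m - k, (ph m k q).2 + m - k) = q := by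
      unfold ph
      apply Prod.ext <;> simp only
      · split_ifs <;> omega
      · omega
    rw [e]
    refine ⟨?_, ?_, ?_, hq.1⟩ <;> unfold ph <;> simp only <;> (try split_ifs) <;> omega
  have hd : Disjoint ((EB m E).image (ph m k)) (W2 n k m E) := by
    rw [disjoint_left]
    intro p hp hq
    obtain ⟨a, b, h⟩ := mem_W2 hq
    have := hB p hp
    omega
  rw [← card_image_of_injOn hinj, ← card_union_of_disjoint hd]
  apply hG
  · intro p hp
    rcases mem_union.1 hp with h | h
    · exact (hB p h).2.2.1
    · obtain ⟨a, b, h⟩ := mem_W2 h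
      unfold Lg
      omega
  · intro C hC hcard hpw
    set I := C.filter (fun p => p.1 = 0 ∨ k ≤ p.1) with hI
    set W := C.filter (fun p => ¬ (p.1 = 0 ∨ k ≤ p.1)) with hW
    have hsum : I.card + W.card = k + 1 := by
      rw [← hcard]; exact card_filter_add_card_filter_not _
    have hIE : ∀ p ∈ I, (p.1 = 0 ∨ k ≤ p.1) ∧ k < p.2 ∧ p ∈ C ∧
        (if p.1 = 0 then 0 else p.1 + m - k, p.2 + m - k) ∈ E := by
      intro p hp
      rw [hI, mem_filter] at hp
      rcases mem_union.1 (hC hp.1) with h | h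
      · have := hB p h
        exact ⟨this.1, this.2.1, hp.1, this.2.2.2⟩
      · obtain ⟨i, b, h⟩ := mem_W2 h
        omega
    have hWW : ∀ p ∈ W, p ∈ W2 n k m E ∧ p ∈ C := by
      intro p hp
      rw [hW, mem_filter] at hp
      rcases mem_union.1 (hC hp.1) with h | h
      · have := hB p h
        omega
      · exact ⟨h, hp.1⟩
    have hsw : ∀ p, p ∈ (TT n k m E).image Prod.swap ↔ p.swap ∈ TT n k m E := by
      intro p
      rw [mem_image]
      constructor
      · rintro ⟨q, hq, rfl⟩; simpa using hq
      · intro h; exact ⟨p.swap, h, by simp⟩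
    have hLTs : ∀ p q : ℕ × ℕ, LT p.swap q.swap ↔ LT p q := by
      intro p q; unfold LT; simp only [Prod.fst_swap, Prod.snd_swap]; tauto
    obtain ⟨D', hDT', hDc, hDch', hDw'⟩ := lift ((TT n k m E).image Prod.swap)
      (fun p => lev (TT n k m E) p.swap)
      (fun p hp q _ h => lev_lt ((hsw p).1 hp) ((hLTs p q).2 h))
      (fun p _ j h1 h2 => by
        obtain ⟨q, hq, hl, he⟩ := lev_pred' h1 h2
        exact ⟨q.swap, (hsw _).2 (by simpa using hq), (hLTs _ _).1 (by simpa using hl),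
          by simpa using he⟩)
      (W.image (fun p => (p.2 + m - k, p.1)))
      (by
        intro p hp q hq hne
        simp only [mem_image] at hp hq
        obtain ⟨p, hp, rfl⟩ := hp
        obtain ⟨q, hq, rfl⟩ := hq
        have hx := hpw p (hWW p hp).2 q (hWW q hq).2 (by rintro rfl; exact hne rfl)
        obtain ⟨i, b, h⟩ := mem_W2 (hWW p hp).1
        obtain ⟨j, c, h'⟩ := mem_W2 (hWW q hq).1
        unfold X at hx
        unfold LT
        simp only
        omega)
      (by
        intro z hz
        simp only [mem_image] at hz
        obtain ⟨p, hp, rfl⟩ := hz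
        obtain ⟨a, b, h⟩ := mem_W2 (hWW p hp).1
        have e : p.2 + m - k = b := by omega
        simp only [e]
        exact ⟨h.1, a, (hsw _).2 (by simpa using h.2.2.2.2.2.1), by simpa using h.2.2.2.2.2.2⟩)
    rw [card_image_of_injOn] at hDc
    · obtain ⟨D, hD⟩ : ∃ D, D = D'.image Prod.swap := ⟨_, rfl⟩
      have hDm : ∀ p, p ∈ D ↔ p.swap ∈ D' := by
        intro p
        rw [hD, mem_image]
        constructor
        · rintro ⟨q, hq, rfl⟩; simpa using hq
        · intro h; exact ⟨p.swap, h, by simp⟩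
      have hDT : D ⊆ TT n k m E := by
        intro p hp
        simpa using (hsw _).1 (hDT' ((hDm p).1 hp))
      have hDch : CH D := by
        intro p hp q hq hne
        have := hDch' _ ((hDm p).1 hp) _ ((hDm q).1 hq) (by simpa using hne)
        rwa [hLTs, hLTs] at this
      have hDcd : D.card = W.card := by
        rw [hD, card_image_of_injective _ Prod.swap_injective, hDc]
      obtain ⟨J, hJ⟩ : ∃ J, J = I.image
        (fun p => (if p.1 = 0 then 0 else p.1 + m - k, p.2 + m - k)) := ⟨_, rfl⟩
      have hJc : J.card = I.card := by
        rw [hJ]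
        apply card_image_of_injOn
        intro p hp q hq h
        have := hIE p hp
        have := hIE q hq
        simp only [Prod.mk.injEq] at h
        apply Prod.ext
        · split_ifs at h <;> omega
        · omega
      have hJm : ∀ q ∈ J, ∃ p ∈ I, (q.1 = if p.1 = 0 then 0 else p.1 + m - k) ∧ q.2 = p.2 + m - k ∧ q ∈ E := by
        intro q hq
        rw [hJ, mem_image] at hq
        obtain ⟨p, hp, rfl⟩ := hq
        exact ⟨p, hp, rfl, rfl, (hIE p hp).2.2.2⟩
      have hdis : Disjoint J D := by
        rw [disjoint_left]
        intro q hq hq'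
        obtain ⟨p, hp, h1, h2, -⟩ := hJm q hq
        have := hIE p hp
        have := (mem_TT.1 (hDT hq')).2
        split_ifs at h1 <;> omega
      have hID : ∀ p ∈ J, ∀ q ∈ D, X p q ∧ X q p := by
        intro r hr q hq
        obtain ⟨p, hp, e1, e2, -⟩ := hJm r hr
        obtain ⟨w, hw, z, hz, h1, h2⟩ := hDw' _ ((hDm q).1 hq)
        simp only [mem_image] at hw hz
        obtain ⟨w, hw, rfl⟩ := hw
        obtain ⟨z, hz, rfl⟩ := hz
        have a1 := hIE p hp
        obtain ⟨_, _, a2⟩ := mem_W2 (hWW w hw).1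
        obtain ⟨_, _, a3⟩ := mem_W2 (hWW z hz).1
        have x1 := hpw p a1.2.2.1 w (hWW w hw).2 (by rintro rfl; omega)
        have x2 := hpw p a1.2.2.1 z (hWW z hz).2 (by rintro rfl; omega)
        have a4 := (mem_TT.1 (hDT hq)).2
        unfold X at x1 x2 ⊢
        simp only [Prod.fst_swap] at h1 h2
        split_ifs at e1 <;> omega
      refine add_short n k E (fun p hp => (hL p hp).2.2) hE (J ∪ D) ?_ ?_ ?_
      · apply union_subset
        · intro p hp
          obtain ⟨_, _, _, _, h⟩ := hJm p hp
          exact mem_union_left _ h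
        · intro p hp; exact (mem_TT.1 (hDT hp)).1
      · rw [card_union_of_disjoint hdis]; omega
      · intro p hp q hq hne
        rcases mem_union.1 hp with hp | hp <;> rcases mem_union.1 hq with hq | hq
        · obtain ⟨p', hp', e1, e2, -⟩ := hJm p hp
          obtain ⟨q', hq', f1, f2, -⟩ := hJm q hq
          have a1 := hIE p' hp'
          have a2 := hIE q' hq'
          have hne' : p' ≠ q' := by
            rintro rfl
            exact hne (Prod.ext (e1.trans f1.symm) (e2.trans f2.symm))
          have x := hpw p' a1.2.2.1 q' a2.2.2.1 hne'
          unfold X at x ⊢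
          have b1 : k ≤ m := by omega
          replace a1 := And.intro a1.1 a1.2.1
          replace a2 := And.intro a2.1 a2.2.1
          clear hk hm1 hm2 hsum hcard hDc hDcd hJc
          rcases x with x | x
          · left
            split_ifs at e1 f1 <;> omega
          · right
            split_ifs at e1 f1 <;> omega
        · exact (hID p hp q hq).1
        · exact (hID q hq p hp).2
        · exact PW_of_CH hDT hDch p hp q hq hne
    · intro p hp q hq h
      obtain ⟨_, _, a2⟩ := mem_W2 (hWW p hp).1
      obtain ⟨_, _, a3⟩ := mem_W2 (hWW q hq).1
      simp only [Prod.mk.injEq] at h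
      apply Prod.ext <;> omega

lemma step (hk : 1 ≤ k) (hL : ∀ p ∈ E, Lg n k p)
    (hE : ∀ C ⊆ E, C.card = k + 1 → ¬ PW C) (hm : (0, m) ∈ E)
    (IH : ∀ n' < n, Good n' k) : E.card ≤ k * (n - (2 * k + 1)) := by
  have hlm := hL _ hm
  unfold Lg at hlm
  simp only at hlm
  have hm1 : k + 1 ≤ m := by omega
  have hm2 : m + k + 1 ≤ n := by omega
  have s1 := side1 hk hm1 hm2 hL hE (IH _ (by omega))
  have s2 := side2 hk hm1 hm2 hL hE (IH _ (by omega))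
  set E' := E.filter (fun p => 1 ≤ p.1 ∧ p.1 < m ∧ m < p.2) with hE'
  have hc : E'.card ≤ ∑ i ∈ Icc 1 (k - 1), ((P1 n k m E i).card + (P2 n k m E i).card + 1) := by
    rw [card_eq_sum_card_fiberwise (f := lev (TT n k m E)) (t := Icc 1 (k - 1))]
    · apply sum_le_sum
      intro i _
      refine le_trans (le_of_eq ?_) (AA_card hm1 hm2 hL hE hm i)
      rw [hE', filter_filter]; rfl
    · intro p hp
      simp only [hE', mem_coe, mem_filter] at hp
      have := lev_le hL hE hm (mem_TT.2 ⟨mem_union_left _ hp.1, hp.2⟩)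
      have := lev_pos (TT n k m E) p
      simp only [coe_Icc, Set.mem_Icc]
      omega
  rw [sum_add_distrib, sum_add_distrib, ← W1_card, ← W2_card] at hc
  simp only [sum_const, Nat.card_Icc, smul_eq_mul, mul_one] at hc
  have hcov : E ⊆ (EA m E ∪ EB m E) ∪ (E' ∪ {(0, m)}) := by
    intro p hp
    have h1 := hL p hp
    unfold Lg at h1
    simp only [EA, EB, hE', mem_union, mem_filter, mem_singleton, hp, true_and]
    by_cases h0 : p = (0, m)
    · tauto
    · simp only [h0, ne_eq, not_false_eq_true, and_true, or_false]
      omega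
  have c1 := card_le_card hcov
  have c2 := card_union_le (EA m E ∪ EB m E) (E' ∪ {(0, m)})
  have c3 := card_union_le (EA m E) (EB m E)
  have c4 := card_union_le E' {(0, m)}
  rw [card_singleton] at c4
  obtain ⟨u, rfl⟩ : ∃ u, m = k + 1 + u := ⟨m - (k + 1), by omega⟩
  obtain ⟨v, rfl⟩ : ∃ v, n = k + 1 + u + k + 1 + v := ⟨n - (k + 1 + u + k + 1), by omega⟩
  have t1 : k + 1 + u + k - (2 * k + 1) = u := by omega
  have t2 : k + 1 + u + k + 1 + v - (k + 1 + u) + k - (2 * k + 1) = v := by omega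
  have t3 : k + 1 + u + k + 1 + v - (2 * k + 1) = u + v + 1 := by omega
  rw [t1] at s1
  rw [t2] at s2
  rw [t3]
  have : k * (u + v + 1) = k * u + k * v + k := by ring
  omega

end step

/-- rotation by one -/
def rot (n : ℕ) (p : ℕ × ℕ) : ℕ × ℕ := if p.1 = 0 then (p.2 - 1, n - 1) else (p.1 - 1, p.2 - 1)

lemma rot_bound {n k : ℕ} (hk : 1 ≤ k) (IH : ∀ n' < n, Good n' k) (x : ℕ) :
    ∀ y (E : Finset (ℕ × ℕ)), (x, y) ∈ E → (∀ p ∈ E, Lg n k p) →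
    (∀ C ⊆ E, C.card = k + 1 → ¬ PW C) → E.card ≤ k * (n - (2 * k + 1)) := by
  induction x with
  | zero => intro y E h hL hE; exact step hk hL hE h IH
  | succ x ih =>
    intro y E h hL hE
    have hinj : ∀ p, Lg n k p → ∀ q, Lg n k q → rot n p = rot n q → p = q := by
      intro p hp q hq h
      unfold Lg at hp hq
      unfold rot at h
      split_ifs at h <;> simp only [Prod.mk.injEq] at h <;> apply Prod.ext <;> omega
    have hX : ∀ p, Lg n k p → ∀ q, Lg n k q → X (rot n p) (rot n q) → X p q := by
      intro p hp q hq h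
      unfold Lg at hp hq
      unfold rot at h
      unfold X at h ⊢
      split_ifs at h <;> simp only at h <;> omega
    rw [← card_image_of_injOn (s := E) (f := rot n) (fun p hp q hq h => hinj p (hL p hp) q (hL q hq) h)]
    apply ih (y - 1)
    · rw [mem_image]
      exact ⟨_, h, by simp [rot]⟩
    · intro q hq
      rw [mem_image] at hq
      obtain ⟨p, hp, rfl⟩ := hq
      have := hL p hp
      unfold Lg at this ⊢
      unfold rot
      split_ifs <;> simp only <;> omega
    · intro C hC hcard hpw
      obtain ⟨D, hD, hDC⟩ := subset_image_iff.1 hC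
      subst hDC
      have hi : Set.InjOn (rot n) D :=
        fun p hp q hq h => hinj p (hL p (hD hp)) q (hL q (hD hq)) h
      rw [card_image_of_injOn hi] at hcard
      apply hE D hD hcard
      intro p hp q hq hne
      apply hX p (hL p (hD hp)) q (hL q (hD hq))
      exact hpw _ (mem_image_of_mem _ hp) _ (mem_image_of_mem _ hq) (fun h => hne (hi hp hq h))

lemma core {k : ℕ} (hk : 1 ≤ k) (n : ℕ) : Good n k := by
  induction n using Nat.strong_induction_on with
  | _ n IH =>
    intro E hL hE
    rcases E.eq_empty_or_nonempty with rfl | ⟨⟨x, y⟩, h⟩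
    · simp
    · exact rot_bound hk IH x y E h hL hE

lemma fin_sub_val {n : ℕ} (x r : Fin n) :
    (x - r).val = if r.val ≤ x.val then x.val - r.val else x.val + n - r.val := by
  split_ifs with h
  · exact Fin.sub_val_of_le h
  · rw [Fin.val_sub]
    have := x.2
    have := r.2
    rw [Nat.mod_eq_of_lt] <;> omega

lemma cross_of_X {n : ℕ} (a b c d : Fin n) (h : X (a.val, b.val) (c.val, d.val)) :
    CrossEdges s(a, b) s(c, d) := by
  unfold X at h
  simp only at h
  rcases h with h | h
  · refine ⟨a, b, c, d, rfl, rfl, a, ?_⟩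
    simp only [List.Chain', List.map_cons, List.map_nil, List.isChain_cons_cons, List.isChain_singleton,
      and_true, Fin.lt_def, fin_sub_val]
    have := a.2
    have := b.2
    have := c.2
    have := d.2
    split_ifs <;> omega
  · refine ⟨b, a, c, d, Sym2.eq_swap, rfl, b, ?_⟩
    simp only [List.Chain', List.map_cons, List.map_nil, List.isChain_cons_cons, List.isChain_singleton,
      and_true, Fin.lt_def, fin_sub_val]
    have := a.2
    have := b.2
    have := c.2
    have := d.2
    split_ifs <;> omega

end CP

theorem capoyleas_pach {n k : ℕ} (hk : 1 ≤ k) (hkn : k ≤ (n - 1) / 2)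
    (G : SimpleGraph (Fin n))
    (hcross : ¬ ∃ E' : Finset (Sym2 (Fin n)), ↑E' ⊆ G.edgeSet ∧ E'.card = k + 1 ∧
        ∀ e ∈ E', ∀ f ∈ E', e ≠ f → CrossEdges e f) :
    G.edgeSet.ncard ≤ 2 * k * n - (2 * k + 1).choose 2 := by
  classical
  let Q : Finset (Fin n × Fin n) := Finset.univ.filter (fun p => p.1 < p.2 ∧ G.Adj p.1 p.2)
  let v : Fin n × Fin n → ℕ × ℕ := fun p => (p.1.val, p.2.val)
  have hv : Function.Injective v := by
    intro p q h
    simp only [v, Prod.mk.injEq] at h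
    exact Prod.ext (Fin.ext h.1) (Fin.ext h.2)
  have hQ : ∀ p ∈ Q, p.1 < p.2 ∧ G.Adj p.1 p.2 := by
    intro p hp; simpa [Q] using hp
  have hsinj : Set.InjOn (fun p : Fin n × Fin n => s(p.1, p.2)) Q := by
    intro p hp q hq h
    have h1 := (hQ p hp).1
    have h2 := (hQ q hq).1
    simp only [Sym2.eq_iff] at h
    rcases h with h | h
    · exact Prod.ext h.1 h.2
    · rw [h.1, h.2] at h1
      exact absurd h1 (not_lt.2 h2.le)
  have hedge : G.edgeSet = ↑(Q.image (fun p : Fin n × Fin n => s(p.1, p.2))) := by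
    ext e
    induction e with
    | _ a b =>
      simp only [SimpleGraph.mem_edgeSet, Finset.coe_image, Set.mem_image, Finset.mem_coe]
      constructor
      · intro h
        rcases lt_or_gt_of_ne h.ne with hlt | hlt
        · exact ⟨(a, b), by simp [Q, hlt, h], rfl⟩
        · exact ⟨(b, a), by simp [Q, hlt, h.symm], Sym2.eq_swap⟩
      · rintro ⟨p, hp, he⟩
        have := (hQ p hp).2
        rw [← SimpleGraph.mem_edgeSet, he, SimpleGraph.mem_edgeSet] at this
        exact this
  have hcard : G.edgeSet.ncard = (Q.image v).card := by
    rw [hedge, Set.ncard_coe_finset, Finset.card_image_of_injOn hsinj,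
      Finset.card_image_of_injective _ hv]
  have hfree : ∀ C ⊆ Q.image v, C.card = k + 1 → ¬ CP.PW C := by
    intro C hC hc hpw
    obtain ⟨D, hD, rfl⟩ := Finset.subset_image_iff.1 hC
    rw [Finset.card_image_of_injective _ hv] at hc
    apply hcross
    refine ⟨D.image (fun p : Fin n × Fin n => s(p.1, p.2)), ?_, ?_, ?_⟩
    · rw [hedge]
      exact_mod_cast Finset.image_subset_image hD
    · rw [Finset.card_image_of_injOn (hsinj.mono (by exact_mod_cast hD)), hc]
    · intro e he f hf hne
      rw [Finset.mem_image] at he hf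
      obtain ⟨p, hp, rfl⟩ := he
      obtain ⟨q, hq, rfl⟩ := hf
      apply CP.cross_of_X
      exact hpw _ (Finset.mem_image_of_mem v hp) _ (Finset.mem_image_of_mem v hq)
        (fun h => hne (by rw [hv h]))
  have hcov : Q.image v ⊆ CP.Sh n k ∪ (Q.image v).filter
      (fun p => p.1 + k + 1 ≤ p.2 ∧ p.2 + k + 1 ≤ p.1 + n ∧ p.2 < n) := by
    intro p hp
    rw [Finset.mem_union, Finset.mem_filter, CP.mem_Sh]
    obtain ⟨q, hq, rfl⟩ := Finset.mem_image.1 hp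
    have h1 : q.1.val < q.2.val := (hQ q hq).1
    have h2 := q.2.2
    simp only [hp, true_and]
    simp only [v]
    omega
  have hlong := CP.core hk n ((Q.image v).filter
      (fun p => p.1 + k + 1 ≤ p.2 ∧ p.2 + k + 1 ≤ p.1 + n ∧ p.2 < n))
    (fun p hp => (Finset.mem_filter.1 hp).2)
    (fun C hC => hfree C (hC.trans (Finset.filter_subset _ _)))
  have hle := (Finset.card_le_card hcov).trans (Finset.card_union_le _ _)
  have hsh := CP.Sh_card n k
  rw [hcard]
  obtain ⟨u, rfl⟩ : ∃ u, n = 2 * k + 1 + u := ⟨n - (2 * k + 1), by omega⟩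
  have hch : (2 * k + 1).choose 2 = k * (2 * k + 1) := by
    rw [Nat.choose_two_right]
    have : (2 * k + 1) * (2 * k + 1 - 1) = k * (2 * k + 1) * 2 := by
      rw [Nat.add_sub_cancel]; ring
    rw [this, Nat.mul_div_cancel _ (by norm_num)]
  rw [hch]
  have t : 2 * k + 1 + u - (2 * k + 1) = u := by omega
  rw [t] at hlong
  have e : 2 * k * (2 * k + 1 + u) = (2 * k + 1 + u) * k + k * u + k * (2 * k + 1) := by ring
  rw [e, Nat.add_sub_cancel]
  omega
end

section
/- For every integer t ≥ 1 there is a constant C_t > 0 such that the following holds. Let M be an n×n 0-1 matrix; say that row i and column j of M cross if M_{ij} = 1, or there exist row indices i₁ < i < i₂ and column indices j₁ < j < j₂ with M_{i j₁} = M_{i j₂} = M_{i₁ j} = M_{i₂ j} = 1. If there do not exist t distinct rows r₁,…,r_t and t distinct columns c₁,…,c_t such that row r_i and column c_j cross for every 1 ≤ i, j ≤ t, then M has at most C_t · n entries equal to 1. -/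
/-- The number of 1-entries of a 0-1 matrix. -/
def onesCount {m n : ℕ} (M : Fin m → Fin n → Bool) : ℕ :=
  (Finset.univ.filter fun p : Fin m × Fin n => M p.1 p.2 = true).card

/-- Row `i` and column `j` of a 0-1 matrix `M` cross if `M i j = 1`, or there are row
indices `i₁ < i < i₂` and column indices `j₁ < j < j₂` with
`M i j₁ = M i j₂ = M i₁ j = M i₂ j = 1`. -/
def RowColCross {n : ℕ} (M : Fin n → Fin n → Bool) (i j : Fin n) : Prop :=
  M i j = true ∨ ∃ i₁ i₂ j₁ j₂ : Fin n, i₁ < i ∧ i < i₂ ∧ j₁ < j ∧ j < j₂ ∧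
    M i j₁ = true ∧ M i j₂ = true ∧ M i₁ j = true ∧ M i₂ j = true

open Classical in
/-- The last `t` elements of `A`. -/
noncomputable def lastT {n : ℕ} (t : ℕ) (A : Finset (Fin n)) : Finset (Fin n) :=
  A.filter fun x => (A.filter fun y => x < y).card < t

open Classical in
/-- The first `t` elements of `A`. -/
noncomputable def firstT {n : ℕ} (t : ℕ) (A : Finset (Fin n)) : Finset (Fin n) :=
  A.filter fun x => (A.filter fun y => y < x).card < t

theorem lastT_card {n t : ℕ} (A : Finset (Fin n)) : (lastT t A).card ≤ t := by
  classical
  rcases (lastT t A).eq_empty_or_nonempty with h | h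
  · simp [h]
  · have hm := Finset.min'_mem _ h
    set m := (lastT t A).min' h with hmdef
    have h2 : (lastT t A).erase m ⊆ A.filter fun y => m < y := by
      intro y hy
      rw [Finset.mem_erase] at hy
      rw [Finset.mem_filter]
      refine ⟨(Finset.mem_filter.1 hy.2).1, lt_of_le_of_ne (Finset.min'_le _ _ hy.2) (Ne.symm hy.1)⟩
    have h3 := Finset.card_le_card h2
    rw [Finset.card_erase_of_mem hm] at h3
    have h4 : (A.filter fun y => m < y).card < t := by
      have := (Finset.mem_filter.1 hm).2
      convert this
    omega

theorem firstT_card {n t : ℕ} (A : Finset (Fin n)) (hA : t ≤ A.card) :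
    t ≤ (firstT t A).card := by
  classical
  by_contra hlt
  push Not at hlt
  have hne : (A \ firstT t A).Nonempty := by
    rw [Finset.sdiff_nonempty]
    intro hs
    have := Finset.card_le_card hs
    omega
  have hm := Finset.min'_mem _ hne
  set m := (A \ firstT t A).min' hne with hmdef
  rw [Finset.mem_sdiff] at hm
  apply hm.2
  unfold firstT
  rw [Finset.mem_filter]
  refine ⟨hm.1, lt_of_le_of_lt (Finset.card_le_card ?_) hlt⟩
  intro y hy
  rw [Finset.mem_filter] at hy
  by_contra hy2
  have := Finset.min'_le (A \ firstT t A) y (Finset.mem_sdiff.2 ⟨hy.1, hy2⟩)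
  exact absurd hy.2 (not_lt.2 this)

open Classical in
/-- Pairs charged to an index `c`. -/
noncomputable def charged {n : ℕ} (t : ℕ) (A : Fin n → Finset (Fin n))
    (B : Fin n → Fin n → Finset (Fin n)) : Finset (Fin n × Fin n) :=
  Finset.univ.biUnion fun c => (lastT t (A c)).biUnion fun j =>
    (lastT t (B c j)).image fun i => (i, j)

theorem charged_card {n t : ℕ} (A : Fin n → Finset (Fin n))
    (B : Fin n → Fin n → Finset (Fin n)) : (charged t A B).card ≤ n * (t * t) := by
  classical
  have h := Finset.card_biUnion_le_card_mul (Finset.univ : Finset (Fin n))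
    (fun c => (lastT t (A c)).biUnion fun j => (lastT t (B c j)).image fun i => (i, j)) (t * t) ?_
  · unfold charged
    simpa using h
  · intro c _
    refine (Finset.card_biUnion_le_card_mul _ _ t ?_).trans
      (Nat.mul_le_mul_right t (lastT_card _))
    intro j _
    exact Finset.card_image_le.trans (lastT_card _)

theorem mem_charged {n t : ℕ} {A : Fin n → Finset (Fin n)}
    {B : Fin n → Fin n → Finset (Fin n)} {i j : Fin n} (c : Fin n)
    (h1 : j ∈ lastT t (A c)) (h2 : i ∈ lastT t (B c j)) : (i, j) ∈ charged t A B := by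
  classical
  unfold charged
  simp only [Finset.mem_biUnion, Finset.mem_univ, true_and, Finset.mem_image]
  exact ⟨c, j, h1, i, h2, rfl⟩

theorem mem_lastT_of {n t : ℕ} {A B : Finset (Fin n)} {x : Fin n} (hx : x ∈ A)
    (hB : B.card < t) (h : ∀ y ∈ A, x < y → y ∈ B) : x ∈ lastT t A := by
  classical
  unfold lastT
  rw [Finset.mem_filter]
  refine ⟨hx, lt_of_le_of_lt (Finset.card_le_card ?_) hB⟩
  intro y hy
  rw [Finset.mem_filter] at hy
  exact h y hy.1 hy.2

theorem mem_lastT_single {n t : ℕ} (ht : 1 ≤ t) (x : Fin n) : x ∈ lastT t {x} := by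
  refine mem_lastT_of (B := ∅) (by simp) (by rw [Finset.card_empty]; omega) ?_
  intro y hy hxy
  simp at hy
  subst hy
  exact absurd hxy (lt_irrefl _)

theorem segments_bound {n t : ℕ} (ht : 1 ≤ t) (act : Fin n → ℕ → Prop)
    (ract : Fin n → Fin n → Prop)
    (hact : ∀ c a h b, a ≤ h → h ≤ b → act c a → act c b → act c h)
    (hract : ∀ i a h b, a ≤ h → h ≤ b → ract i a → ract i b → ract i h)
    (hno : ¬ ∃ R Cols : Finset (Fin n), R.card = t ∧ Cols.card = t ∧
            ∀ i ∈ R, ∀ j ∈ Cols, act j i ∧ ract i j)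
    (S : Finset (Fin n × Fin n)) (hS : ∀ p ∈ S, act p.2 p.1 ∧ ract p.1 p.2) :
    S.card ≤ 5 * (n * (t * t)) := by
  classical
  have htop : ∀ c, ∃ h, ∀ h', act c h' → ¬ act c (h' + 1) → h' = h := by
    intro c
    by_cases h : ∃ h, act c h ∧ ¬ act c (h + 1)
    · obtain ⟨h, h1, h2⟩ := h
      refine ⟨h, fun h' h3 h4 => ?_⟩
      rcases lt_trichotomy h' h with hl | hl | hl
      · exact absurd (hact c h' (h' + 1) h (by omega) (by omega) h3 h1) h4
      · exact hl
      · exact absurd (hact c h (h + 1) h' (by omega) (by omega) h1 h3) h2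
    · push Not at h
      exact ⟨0, fun h' h3 h4 => absurd (h h' h3) h4⟩
  have hbot : ∀ c, ∃ h, ∀ h', ¬ act c h' → act c (h' + 1) → h' = h := by
    intro c
    by_cases h : ∃ h, ¬ act c h ∧ act c (h + 1)
    · obtain ⟨h, h1, h2⟩ := h
      refine ⟨h, fun h' h3 h4 => ?_⟩
      rcases lt_trichotomy h' h with hl | hl | hl
      · exact absurd (hact c (h' + 1) h (h + 1) (by omega) (by omega) h4 h2) h1
      · exact hl
      · exact absurd (hact c (h + 1) h' (h' + 1) (by omega) (by omega) h2 h4) h3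
    · push Not at h
      exact ⟨0, fun h' h3 h4 => absurd h4 (h h' h3)⟩
  choose tp htp using htop
  choose bt hbt using hbot
  let P : Fin n → Fin n → Prop := fun i c => act c i ∧ ract i c
  let rowP : Fin n → Finset (Fin n) := fun i => Finset.univ.filter fun c => P i c
  let colP : Fin n → Finset (Fin n) := fun j => Finset.univ.filter fun r => P r j
  let evA : (Fin n → ℕ) → Fin n → Finset (Fin n) := fun g c =>
    Finset.univ.filter fun c' => c' < c ∧ act c' (g c)
  let evB : (Fin n → ℕ) → Fin n → Fin n → Finset (Fin n) := fun g c j =>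
    Finset.univ.filter fun r => (r : ℕ) ≤ g c ∧ P r j
  let Z1 := charged t rowP (fun c _ => {c})
  let Z2 := charged t (fun c => {c}) (fun c _ => colP c)
  let Z3 := charged t rowP (fun c j => Finset.univ.filter fun r => r < c ∧ P r j)
  let Z4 := charged t (evA tp) (evB tp)
  let Z5 := charged t (evA bt) (evB bt)
  have hsub : S ⊆ Z1 ∪ Z2 ∪ Z3 ∪ Z4 ∪ Z5 := by
    rintro ⟨i, j⟩ hij
    have hP : P i j := hS _ hij
    by_contra hZ
    simp only [Finset.mem_union, not_or] at hZ
    obtain ⟨⟨⟨⟨hZ1, hZ2⟩, hZ3⟩, hZ4⟩, hZ5⟩ := hZ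
    -- columns to the right, rows above
    let A := Finset.univ.filter fun c => j < c ∧ P i c
    let B := Finset.univ.filter fun r => i < r ∧ P r j
    have hA : t ≤ A.card := by
      by_contra hlt
      push Not at hlt
      refine hZ1 (mem_charged i (mem_lastT_of (B := A) ?_ hlt ?_) (mem_lastT_single ht i))
      · simp [rowP, hP]
      · intro y hy hjy
        simp only [rowP, Finset.mem_filter] at hy
        simp [A, hjy, hy.2]
    have hB : t ≤ B.card := by
      by_contra hlt
      push Not at hlt
      refine hZ2 (mem_charged j (mem_lastT_single ht j) (mem_lastT_of (B := B) ?_ hlt ?_))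
      · simp [colP, hP]
      · intro y hy hjy
        simp only [colP, Finset.mem_filter] at hy
        simp [B, hjy, hy.2]
    obtain ⟨Cs, hCs, hCc⟩ := Finset.exists_subset_card_eq (firstT_card A hA)
    obtain ⟨Rs, hRs, hRc⟩ := Finset.exists_subset_card_eq (firstT_card B hB)
    refine hno ⟨Rs, Cs, hRc, hCc, fun i' hi' j' hj' => ?_⟩
    have hi2 := Finset.mem_filter.1 (hRs hi')
    have hj2 := Finset.mem_filter.1 (hCs hj')
    obtain ⟨hi3, hi4⟩ := hi2
    obtain ⟨hj3, hj4⟩ := hj2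
    simp only [B, Finset.mem_filter, Finset.mem_univ, true_and] at hi3
    simp only [A, Finset.mem_filter, Finset.mem_univ, true_and] at hj3
    obtain ⟨hii, hPi⟩ := hi3
    obtain ⟨hjj, hPj⟩ := hj3
    have hii' : (i : ℕ) < i' := hii
    by_contra hnP
    -- the number of active columns strictly between j and j'
    let D : ℕ → Finset (Fin n) := fun h => Finset.univ.filter fun c => j < c ∧ c < j' ∧ act c h
    let Q : ℕ → Prop := fun h => act j' h ∧ (D h).card < t
    have hQi : Q i := by
      refine ⟨hPj.1, lt_of_le_of_lt (Finset.card_le_card ?_) hj4⟩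
      intro c hc
      simp only [D, Finset.mem_filter, Finset.mem_univ, true_and] at hc
      simp only [A, Finset.mem_filter, Finset.mem_univ, true_and]
      exact ⟨⟨hc.1, hc.2.2, hract i j c j' hc.1.le hc.2.1.le hP.2 hPj.2⟩, hc.2.1⟩
    have hactj : ∀ h : ℕ, (i : ℕ) ≤ h → h ≤ i' → act j h := fun h h1 h2 =>
      hact j i h i' h1 h2 hP.1 hPi.1
    by_cases hQ : Q i'
    · apply hZ3
      refine mem_charged i' (mem_lastT_of (B := D i') ?_ hQ.2 ?_) (mem_lastT_of ?_ hi4 ?_)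
      · simp [rowP, hPi]
      · intro y hy hjy
        simp only [rowP, Finset.mem_filter, Finset.mem_univ, true_and] at hy
        simp only [D, Finset.mem_filter, Finset.mem_univ, true_and]
        refine ⟨hjy, ?_, hy.1⟩
        by_contra hle
        push Not at hle
        exact hnP ⟨hQ.1, hract i' j j' y hjj.le hle hPi.2 hy.2⟩
      · simp [hP, hii]
      · intro y hy hiy
        simp only [Finset.mem_filter, Finset.mem_univ, true_and] at hy
        simp only [B, Finset.mem_filter, Finset.mem_univ, true_and]
        exact ⟨⟨hiy, hy.2⟩, hy.1⟩
    · -- first change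
      have hex : ∃ h : ℕ, (i : ℕ) ≤ h ∧ h + 1 ≤ i' ∧ Q h ∧ ¬ Q (h + 1) := by
        by_contra hcon
        push Not at hcon
        have : ∀ h : ℕ, (i : ℕ) ≤ h → h ≤ i' → Q h := by
          intro h hh
          induction h, hh using Nat.le_induction with
          | base => exact fun _ => hQi
          | succ k hk ih => exact fun hk2 => hcon k hk hk2 (ih (by omega))
        exact hQ (this i' hii'.le le_rfl)
      obtain ⟨h, h1, h2, hQh, hQh'⟩ := hex
      have key : ∀ g : Fin n → ℕ, ∀ c, j < c → c ≤ j' → g c = h →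
          (i, j) ∈ charged t (evA g) (evB g) := by
        intro g c hjc hcj hg
        refine mem_charged c (mem_lastT_of (B := D h) ?_ hQh.2 ?_) (mem_lastT_of ?_ hi4 ?_)
        · simp only [evA, Finset.mem_filter, Finset.mem_univ, true_and, hg]
          exact ⟨hjc, hactj h h1 (by omega)⟩
        · intro y hy hjy
          simp only [evA, Finset.mem_filter, Finset.mem_univ, true_and, hg] at hy
          simp only [D, Finset.mem_filter, Finset.mem_univ, true_and]
          exact ⟨hjy, lt_of_lt_of_le hy.1 hcj, hy.2⟩
        · simp only [evB, Finset.mem_filter, Finset.mem_univ, true_and, hg]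
          exact ⟨h1, hP⟩
        · intro y hy hiy
          simp only [evB, Finset.mem_filter, Finset.mem_univ, true_and, hg] at hy
          simp only [B, Finset.mem_filter, Finset.mem_univ, true_and]
          refine ⟨⟨hiy, hy.2⟩, ?_⟩
          rw [Fin.lt_def]
          omega
      by_cases ha : act j' (h + 1)
      · have hcard : ¬ (D (h + 1)).card < t := fun hc => hQh' ⟨ha, hc⟩
        have hns : ¬ D (h + 1) ⊆ D h := fun hs =>
          hcard (lt_of_le_of_lt (Finset.card_le_card hs) hQh.2)
        obtain ⟨c, hc1, hc2⟩ := Finset.not_subset.1 hns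
        simp only [D, Finset.mem_filter, Finset.mem_univ, true_and] at hc1 hc2
        exact hZ5 (key bt c hc1.1 hc1.2.1.le
          (hbt c h (fun hh => hc2 ⟨hc1.1, hc1.2.1, hh⟩) hc1.2.2).symm)
      · exact hZ4 (key tp j' hjj le_rfl (htp j' h hQh.1 ha).symm)
  have e1 : Z1.card ≤ n * (t * t) := charged_card _ _
  have e2 : Z2.card ≤ n * (t * t) := charged_card _ _
  have e3 : Z3.card ≤ n * (t * t) := charged_card _ _
  have e4 : Z4.card ≤ n * (t * t) := charged_card _ _
  have e5 : Z5.card ≤ n * (t * t) := charged_card _ _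
  have f := Finset.card_le_card hsub
  have f1 := Finset.card_union_le (Z1 ∪ Z2 ∪ Z3 ∪ Z4) Z5
  have f2 := Finset.card_union_le (Z1 ∪ Z2 ∪ Z3) Z4
  have f3 := Finset.card_union_le (Z1 ∪ Z2) Z3
  have f4 := Finset.card_union_le Z1 Z2
  omega

/-- For every `t ≥ 1` there is a constant `C > 0` such that every `n×n` 0-1 matrix
without `t` distinct rows and `t` distinct columns that pairwise cross has at most
`C·n` 1-entries. -/
theorem no_crossing_rows_cols_ub :
    ∀ t : ℕ, 1 ≤ t → ∃ C : ℝ, 0 < C ∧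
      ∀ n : ℕ, ∀ M : Fin n → Fin n → Bool,
        (¬ ∃ R Cols : Finset (Fin n), R.card = t ∧ Cols.card = t ∧
            ∀ i ∈ R, ∀ j ∈ Cols, RowColCross M i j) →
        (onesCount M : ℝ) ≤ C * n := by
  intro t ht
  refine ⟨5 * (t * t), by positivity, fun n M hM => ?_⟩
  have hb := segments_bound (n := n) ht
    (fun c h => ∃ i₁ i₂ : Fin n, (i₁ : ℕ) ≤ h ∧ h ≤ i₂ ∧ M i₁ c = true ∧ M i₂ c = true)
    (fun i c => ∃ j₁ j₂ : Fin n, j₁ ≤ c ∧ c ≤ j₂ ∧ M i j₁ = true ∧ M i j₂ = true)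
    ?_ ?_ ?_ (Finset.univ.filter fun p : Fin n × Fin n => M p.1 p.2 = true) ?_
  · have : onesCount M ≤ 5 * (n * (t * t)) := hb
    have h2 : (onesCount M : ℝ) ≤ ((5 * (n * (t * t)) : ℕ) : ℝ) := by exact_mod_cast this
    push_cast at h2
    linarith
  · rintro c a h b hah hhb ⟨x, _, hx, _, hx2, _⟩ ⟨_, y, _, hy, _, hy2⟩
    exact ⟨x, y, by omega, by omega, hx2, hy2⟩
  · rintro c a h b hah hhb ⟨x, _, hx, _, hx2, _⟩ ⟨_, y, _, hy, _, hy2⟩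
    exact ⟨x, y, hx.trans hah, hhb.trans hy, hx2, hy2⟩
  · rintro ⟨R, Cs, hR, hC, h⟩
    refine hM ⟨R, Cs, hR, hC, fun i hi j hj => ?_⟩
    obtain ⟨⟨i₁, i₂, a1, a2, a3, a4⟩, ⟨j₁, j₂, b1, b2, b3, b4⟩⟩ := h i hi j hj
    by_cases hone : M i j = true
    · exact Or.inl hone
    · right
      have g : ∀ k : Fin n, M k j = true → k ≠ i := fun k hk he => hone (he ▸ hk)
      have g' : ∀ k : Fin n, M i k = true → k ≠ j := fun k hk he => hone (he ▸ hk)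
      exact ⟨i₁, i₂, j₁, j₂, lt_of_le_of_ne a1 (g _ a3), lt_of_le_of_ne a2 (g _ a4).symm,
        lt_of_le_of_ne b1 (g' _ b3), lt_of_le_of_ne b2 (g' _ b4).symm, b3, b4, a3, a4⟩
  · intro p hp
    have hp := (Finset.mem_filter.1 hp).2
    exact ⟨⟨p.1, p.1, le_rfl, le_rfl, hp, hp⟩, ⟨p.2, p.2, le_rfl, le_rfl, hp, hp⟩⟩
end

section
/- For every integer t ≥ 1 there is a constant C_t > 0 such that the following holds. Let G = (A ∪ B, E) be a finite bipartite ordered graph whose vertex classes satisfy A < B (every vertex of A is smaller than every vertex of B) and all of whose edges join A to B. If G does not contain a t-element subset A' ⊆ A and a t-element subset B' ⊆ B such that every vertex of A' and every vertex of B' form a double cherry, then G has at most C_t · (|A| + |B|) edges. -/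
open Finset in
theorem dc_exists_nth {α : Type*} [LinearOrder α] (t : ℕ) (ht : 1 ≤ t) (S : Finset α) :
    t ≤ #S → ∃ d ∈ S, #(S.filter (fun x => x ≤ d)) = t := by
  classical
  induction S using Finset.induction_on_max with
  | empty => intro h; simp at h; omega
  | insert a S hlt ih =>
    intro h
    have ha : a ∉ S := fun h' => lt_irrefl _ (hlt a h')
    rw [card_insert_of_notMem ha] at h
    by_cases hS : t ≤ #S
    · obtain ⟨d, hd, hc⟩ := ih hS
      refine ⟨d, mem_insert_of_mem hd, ?_⟩
      rw [filter_insert, if_neg (not_le.2 (hlt d hd)), hc]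
    · refine ⟨a, mem_insert_self _ _, ?_⟩
      rw [filter_true_of_mem, card_insert_of_notMem ha]
      · omega
      · intro x hx
        rcases mem_insert.1 hx with rfl | hx
        · exact le_rfl
        · exact (hlt x hx).le

open Finset Classical in
theorem dc_core {α β : Type*} [LinearOrder α] [LinearOrder β] (A : Finset α) (B : Finset β)
    (P Q : α → β → Prop) (t : ℕ) (ht : 1 ≤ t)
    (hP : ∀ v x y z, x ≤ y → y ≤ z → P x v → P z v → P y v)
    (hQ : ∀ r x y z, x ≤ y → y ≤ z → Q r x → Q r z → Q r y)
    (hno : ∀ A' ⊆ A, ∀ B' ⊆ B, #A' = t → #B' = t → ∃ a ∈ A', ∃ b ∈ B', ¬ (P a b ∧ Q a b)) :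
    #((A ×ˢ B).filter (fun p => P p.1 p.2 ∧ Q p.1 p.2)) ≤ t * #A + 2 * #B * (t * (t + 1)) := by
  set H := (A ×ˢ B).filter (fun p => P p.1 p.2 ∧ Q p.1 p.2) with hH
  let Win : α → β → β → Prop := fun r c d => d ∈ B ∧ c ≤ d ∧ P r d ∧ Q r d ∧
    #(B.filter (fun v => c ≤ v ∧ v ≤ d ∧ P r v)) = t
  -- non-windows
  have h1 : #(H.filter (fun p => ¬ ∃ d, Win p.1 p.2 d)) ≤ t * #A := by
    have := Finset.card_le_mul_card_image (f := Prod.fst)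
      (H.filter (fun p => ¬ ∃ d, Win p.1 p.2 d)) t ?_
    · refine this.trans (Nat.mul_le_mul_left _ (card_le_card ?_))
      intro r hr
      simp only [mem_image, mem_filter, hH, mem_product] at hr
      obtain ⟨p, hp, rfl⟩ := hr
      exact hp.1.1.1
    · intro r _
      let Hr := B.filter (fun c => P r c ∧ Q r c)
      refine le_of_le_of_eq ?_ (card_range t)
      refine card_le_card_of_injOn (fun p => #(Hr.filter (fun x => p.2 ≤ x))) ?_ ?_
      · rintro ⟨r', c⟩ hp
        simp only [hH, coe_filter, mem_filter, mem_product, Set.mem_ofPred_eq] at hp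
        obtain ⟨⟨⟨⟨hr, hc⟩, hPc, hQc⟩, hn⟩, rfl⟩ := hp
        simp only [coe_range, Set.mem_Iio]
        by_contra hge
        apply hn
        obtain ⟨d, hd, hcard⟩ := dc_exists_nth t ht _ (not_lt.1 hge)
        simp only [mem_filter, Hr] at hd
        refine ⟨d, hd.1.1, hd.2, hd.1.2.1, hd.1.2.2, ?_⟩
        rw [← hcard]
        congr 1
        ext x
        simp only [mem_filter, Hr]
        constructor
        · rintro ⟨a, b, c', e⟩
          exact ⟨⟨⟨a, e, hQ _ _ _ _ b c' hQc hd.1.2.2⟩, b⟩, c'⟩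
        · rintro ⟨⟨⟨a, e, _⟩, b⟩, c'⟩
          exact ⟨a, b, c', e⟩
      · have key : ∀ c c', c ∈ Hr → c < c' →
            #(Hr.filter (fun x => c' ≤ x)) < #(Hr.filter (fun x => c ≤ x)) := by
          intro c c' hc hlt
          apply card_lt_card
          refine (ssubset_iff_of_subset ?_).2 ⟨c, ?_, ?_⟩
          · intro x hx
            simp only [mem_filter] at hx ⊢
            exact ⟨hx.1, hlt.le.trans hx.2⟩
          · simp [hc]
          · simp [hlt]
        rintro ⟨r₁, c₁⟩ hp₁ ⟨r₂, c₂⟩ hp₂ heq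
        simp only [hH, coe_filter, mem_filter, mem_product, Set.mem_ofPred_eq] at hp₁ hp₂
        obtain ⟨⟨⟨⟨hr₁, hc₁⟩, hPc₁, hQc₁⟩, hn₁⟩, rfl⟩ := hp₁
        obtain ⟨⟨⟨⟨hr₂, hc₂⟩, hPc₂, hQc₂⟩, hn₂⟩, rfl⟩ := hp₂
        have m₁ : c₁ ∈ Hr := by simp [Hr, *]
        have m₂ : c₂ ∈ Hr := by simp [Hr, *]
        dsimp only at heq
        rcases lt_trichotomy c₁ c₂ with h | h | h
        · have := key _ _ m₁ h; omega
        · rw [h]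
        · have := key _ _ m₂ h; omega
  -- events
  let E1 := (A ×ˢ B).filter (fun p => P p.1 p.2 ∧ ∀ q ∈ A, p.1 < q → ¬ P q p.2)
  let E2 := (A ×ˢ B).filter (fun p => (∀ s ∈ A, s ≤ p.1 → ¬ P s p.2) ∧
    ∃ q ∈ A, p.1 < q ∧ P q p.2 ∧ ∀ z ∈ A, p.1 < z → q ≤ z)
  have hE1 : #E1 ≤ #B := by
    refine card_le_card_of_injOn Prod.snd ?_ ?_
    · intro p hp
      simp only [E1, coe_filter, Set.mem_ofPred_eq, mem_product] at hp
      exact hp.1.2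
    · rintro ⟨r₁, c₁⟩ hp₁ ⟨r₂, c₂⟩ hp₂ heq
      simp only [E1, coe_filter, Set.mem_ofPred_eq, mem_product] at hp₁ hp₂ heq
      subst heq
      rcases lt_trichotomy r₁ r₂ with h | h | h
      · exact absurd hp₂.2.1 (hp₁.2.2 _ hp₂.1.1 h)
      · rw [h]
      · exact absurd hp₁.2.1 (hp₂.2.2 _ hp₁.1.1 h)
  have hE2 : #E2 ≤ #B := by
    refine card_le_card_of_injOn Prod.snd ?_ ?_
    · intro p hp
      simp only [E2, coe_filter, Set.mem_ofPred_eq, mem_product] at hp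
      exact hp.1.2
    · rintro ⟨r₁, c₁⟩ hp₁ ⟨r₂, c₂⟩ hp₂ heq
      simp only [E2, coe_filter, Set.mem_ofPred_eq, mem_product] at hp₁ hp₂ heq
      subst heq
      obtain ⟨⟨hr₁, _⟩, ha₁, q₁, hq₁, hl₁, hPq₁, hm₁⟩ := hp₁
      obtain ⟨⟨hr₂, _⟩, ha₂, q₂, hq₂, hl₂, hPq₂, hm₂⟩ := hp₂
      rcases lt_trichotomy r₁ r₂ with h | h | h
      · exact absurd hPq₁ (ha₂ _ hq₁ (hm₁ _ hr₂ h))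
      · rw [h]
      · exact absurd hPq₂ (ha₁ _ hq₂ (hm₂ _ hr₁ h))
  let K : α × β → Finset (α × β) := fun e => H.filter (fun p => ∃ d, Win p.1 p.2 d ∧
    p.2 ≤ e.2 ∧ e.2 ≤ d ∧ ∀ v ∈ B, p.2 ≤ v → v ≤ d → (P e.1 v ↔ P p.1 v))
  have hK : ∀ e ∈ E1 ∪ E2, #(K e) ≤ t * (t + 1) := by
    rintro ⟨s, w⟩ _
    refine (Finset.card_le_mul_card_image (f := Prod.snd) (K (s, w)) t ?_).trans
      (Nat.mul_le_mul_left _ ?_)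
    · intro c _
      by_contra hgt
      push Not at hgt
      set F := (K (s, w)).filter (fun p => p.2 = c) with hF
      have hinj : Set.InjOn Prod.fst (F : Set (α × β)) := by
        rintro ⟨r₁, c₁⟩ hp₁ ⟨r₂, c₂⟩ hp₂ heq
        simp only [hF, coe_filter, Set.mem_ofPred_eq] at hp₁ hp₂ heq
        rw [heq, hp₁.2, hp₂.2]
      have hF1 : t ≤ #(F.image Prod.fst) := by
        rw [card_image_of_injOn hinj]; exact hgt.le
      obtain ⟨A', hA', hcA⟩ := exists_subset_card_eq hF1
      have hmem : ∀ a ∈ A', a ∈ A ∧ P a c ∧ Q a c ∧ ∃ d, Win a c d ∧ c ≤ w ∧ w ≤ d ∧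
          ∀ v ∈ B, c ≤ v → v ≤ d → (P s v ↔ P a v) := by
        intro a ha
        have := hA' ha
        simp only [hF, K, hH, mem_image, mem_filter, mem_product] at this
        obtain ⟨⟨r, c'⟩, ⟨⟨⟨⟨h1, h2⟩, h3, h4⟩, h5⟩, rfl⟩, rfl⟩ := this
        exact ⟨h1, h3, h4, h5⟩
      have hne : A'.Nonempty := by
        rw [← card_pos]; omega
      obtain ⟨a₀, ha₀⟩ := hne
      obtain ⟨_, _, _, d, ⟨hdB, hcd, hPd, hQd, hcard⟩, hcw, hwd, hsame⟩ := hmem a₀ ha₀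
      have hs : ∀ d', #(B.filter (fun v => c ≤ v ∧ v ≤ d' ∧ P s v)) = t → d' ∈ B → P s d' →
          c ≤ d' → ∀ d'', #(B.filter (fun v => c ≤ v ∧ v ≤ d'' ∧ P s v)) = t → d' ≤ d'' := by
        intro d' hc' hB' hP' hcd' d'' hc''
        by_contra hlt
        push Not at hlt
        have : #(B.filter (fun v => c ≤ v ∧ v ≤ d'' ∧ P s v)) <
            #(B.filter (fun v => c ≤ v ∧ v ≤ d' ∧ P s v)) := by
          apply card_lt_card
          refine (ssubset_iff_of_subset ?_).2 ⟨d', ?_, ?_⟩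
          · intro x hx
            simp only [mem_filter] at hx ⊢
            exact ⟨hx.1, hx.2.1, hx.2.2.1.trans hlt.le, hx.2.2.2⟩
          · simp [*]
          · simp [hlt]
        omega
      have htr : ∀ a d', (∀ v ∈ B, c ≤ v → v ≤ d' → (P s v ↔ P a v)) →
          B.filter (fun v => c ≤ v ∧ v ≤ d' ∧ P s v) =
          B.filter (fun v => c ≤ v ∧ v ≤ d' ∧ P a v) := by
        intro a d' h
        apply filter_congr
        intro x hx
        constructor
        · rintro ⟨h1, h2, h3⟩
          exact ⟨h1, h2, (h x hx h1 h2).1 h3⟩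
        · rintro ⟨h1, h2, h3⟩
          exact ⟨h1, h2, (h x hx h1 h2).2 h3⟩
      have hcs := hcard
      rw [← htr a₀ d hsame] at hcs
      obtain ⟨a, ha, b, hb, hbad⟩ := hno A' (fun a ha => (hmem a ha).1)
        (B.filter (fun v => c ≤ v ∧ v ≤ d ∧ P s v)) (filter_subset _ _) hcA hcs
      apply hbad
      simp only [mem_filter] at hb
      obtain ⟨_, _, hQc, d', ⟨hdB', hcd', hPd', hQd', hcard'⟩, hcw', hwd', hsame'⟩ := hmem a ha
      rw [← htr a d' hsame'] at hcard'
      have hdd : d ≤ d' := hs d hcs hdB ((hsame d hdB hcd le_rfl).2 hPd) hcd d' hcard'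
      refine ⟨(hsame' b hb.1 hb.2.1 (hb.2.2.1.trans hdd)).1 hb.2.2.2, ?_⟩
      exact hQ _ _ _ _ hb.2.1 (hb.2.2.1.trans hdd) hQc hQd'
    · rw [← card_range (t + 1)]
      have hmem : ∀ c ∈ (K (s, w)).image Prod.snd, c ∈ B ∧ P s c ∧ c ≤ w ∧
          #(B.filter (fun v => c ≤ v ∧ v ≤ w ∧ P s v)) ≤ t := by
        intro c hc
        simp only [K, hH, mem_image, mem_filter, mem_product] at hc
        obtain ⟨⟨r, c'⟩, ⟨⟨⟨h1, h2⟩, h3, h4⟩, d, ⟨hdB, hcd, hPd, hQd, hcard⟩, hcw, hwd, hsame⟩,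
          rfl⟩ := hc
        refine ⟨h2, (hsame _ h2 le_rfl hcd).2 h3, hcw, ?_⟩
        rw [← hcard]
        apply card_le_card
        intro x hx
        simp only [mem_filter] at hx ⊢
        exact ⟨hx.1, hx.2.1, hx.2.2.1.trans hwd,
          (hsame _ hx.1 hx.2.1 (hx.2.2.1.trans hwd)).1 hx.2.2.2⟩
      refine card_le_card_of_injOn
        (fun c => #(B.filter (fun v => c ≤ v ∧ v ≤ w ∧ P s v))) ?_ ?_
      · intro c hc
        have := (hmem c hc).2.2.2
        simp only [coe_range, Set.mem_Iio]
        omega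
      · have key : ∀ c c', c ∈ (K (s, w)).image Prod.snd → c < c' →
            #(B.filter (fun v => c' ≤ v ∧ v ≤ w ∧ P s v)) <
            #(B.filter (fun v => c ≤ v ∧ v ≤ w ∧ P s v)) := by
          intro c c' hc hlt
          obtain ⟨hB, hPc, hcw, _⟩ := hmem c hc
          apply card_lt_card
          refine (ssubset_iff_of_subset ?_).2 ⟨c, ?_, ?_⟩
          · intro x hx
            simp only [mem_filter] at hx ⊢
            exact ⟨hx.1, hlt.le.trans hx.2.1, hx.2.2⟩
          · simp [*]
          · simp [hlt]
        intro c₁ m₁ c₂ m₂ heq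
        dsimp only at heq
        rcases lt_trichotomy c₁ c₂ with h | h | h
        · have := key _ _ m₁ h; omega
        · exact h
        · have := key _ _ m₂ h; omega
  have h2 : #(H.filter (fun p => ∃ d, Win p.1 p.2 d)) ≤ 2 * #B * (t * (t + 1)) := by
    have hsub : H.filter (fun p => ∃ d, Win p.1 p.2 d) ⊆ (E1 ∪ E2).biUnion K := by
      rintro ⟨r, c⟩ hp
      obtain ⟨hpH, d, hW⟩ := mem_filter.1 hp
      obtain ⟨hdB, hcd, hPd, hQd, hcard⟩ := id hW
      dsimp only at hdB hcd hPd hQd hcard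
      have hpH' := hpH
      simp only [hH, mem_filter, mem_product] at hpH'
      obtain ⟨⟨hrA, hcB⟩, hPc, hQc⟩ := hpH'
      let Good : α → Prop := fun s => ∀ v ∈ B, c ≤ v → v ≤ d → (P s v ↔ P r v)
      let S := A.filter (fun s => r ≤ s ∧ ∀ z ∈ A, r ≤ z → z ≤ s → Good z)
      have hrS : r ∈ S := by
        simp only [S, mem_filter]
        refine ⟨hrA, le_rfl, ?_⟩
        intro z _ h1 h2
        obtain rfl := le_antisymm h1 h2
        exact fun v _ _ _ => Iff.rfl
      obtain ⟨s, hsS, hsmax⟩ := S.exists_max_image id ⟨r, hrS⟩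
      have hsS' := hsS
      simp only [S, mem_filter] at hsS'
      obtain ⟨hsA, hrs, hgood⟩ := hsS'
      have hgs := hgood s hsA hrs le_rfl
      suffices hsuf : ∃ v ∈ B, c ≤ v ∧ v ≤ d ∧ (s, v) ∈ E1 ∪ E2 by
        obtain ⟨v, hv, hcv, hvd, hE⟩ := hsuf
        refine mem_biUnion.2 ⟨(s, v), hE, ?_⟩
        exact mem_filter.2 ⟨hpH, d, hW, hcv, hvd, hgs⟩
      by_cases hq : (A.filter (fun q => s < q)).Nonempty
      · obtain ⟨q, hqm, hqmin⟩ := (A.filter (fun q => s < q)).exists_min_image id hq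
        simp only [mem_filter, id] at hqm hqmin
        obtain ⟨hqA, hsq⟩ := hqm
        have hbad : ¬ Good q := by
          intro hg
          have : q ∈ S := by
            simp only [S, mem_filter]
            refine ⟨hqA, hrs.trans hsq.le, ?_⟩
            intro z hz h1 h2
            rcases le_or_gt z s with h | h
            · exact hgood z hz h1 h
            · obtain rfl := le_antisymm h2 (hqmin z ⟨hz, h⟩)
              exact hg
          exact absurd (hsmax q this) (not_le.2 hsq)
        simp only [Good] at hbad
        push Not at hbad
        obtain ⟨v, hv, hcv, hvd, hiff⟩ := hbad
        refine ⟨v, hv, hcv, hvd, mem_union.2 ?_⟩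
        have hsv := hgs v hv hcv hvd
        by_cases hPs : P s v
        · left
          have hPq : ¬ P q v := by tauto
          simp only [E1, mem_filter, mem_product]
          refine ⟨⟨hsA, hv⟩, hPs, ?_⟩
          intro z hz hsz hPz
          exact hPq (hP v s q z hsq.le (hqmin z ⟨hz, hsz⟩) hPs hPz)
        · right
          have hPq : P q v := by tauto
          simp only [E2, mem_filter, mem_product]
          refine ⟨⟨hsA, hv⟩, ?_, q, hqA, hsq, hPq, fun z hz h => hqmin z ⟨hz, h⟩⟩
          intro z hz hzs hPz
          exact hPs (hP v z s q hzs hsq.le hPz hPq)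
      · refine ⟨c, hcB, le_rfl, hcd, mem_union_left _ ?_⟩
        simp only [E1, mem_filter, mem_product]
        refine ⟨⟨hsA, hcB⟩, (hgs c hcB le_rfl hcd).2 hPc, ?_⟩
        intro q hqA hsq
        exact absurd ⟨q, mem_filter.2 ⟨hqA, hsq⟩⟩ hq
    refine (card_le_card hsub).trans ((card_biUnion_le_card_mul _ _ _ hK).trans ?_)
    apply Nat.mul_le_mul_right
    have := card_union_le E1 E2
    omega
  have h3 := card_filter_add_card_filter_not (s := H) (fun p => ∃ d, Win p.1 p.2 d)
  omega


/-- In an ordered graph `G`, two vertices `u < v` form a double cherry if either `uv` is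
an edge of `G`, or there exist vertices `u₁ < u < u₂ < v₁ < v < v₂` such that
`uv₁`, `uv₂`, `vu₁` and `vu₂` are all edges of `G`. -/
def DoubleCherry {V : Type*} [LinearOrder V] (G : SimpleGraph V) (u v : V) : Prop :=
  G.Adj u v ∨ ∃ u₁ u₂ v₁ v₂ : V, u₁ < u ∧ u < u₂ ∧ u₂ < v₁ ∧ v₁ < v ∧ v < v₂ ∧
    G.Adj u v₁ ∧ G.Adj u v₂ ∧ G.Adj v u₁ ∧ G.Adj v u₂

/-- For every `t ≥ 1` there is a constant `C > 0` such that the following holds.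
Let `G` be a finite bipartite ordered graph with classes `A < B`, all of whose edges
join `A` to `B`. If `G` has no `t`-element subsets `A' ⊆ A` and `B' ⊆ B` such that every
vertex of `A'` and every vertex of `B'` form a double cherry, then `G` has at most
`C·(|A| + |B|)` edges. -/
theorem double_cherry_separated_ub :
    ∀ t : ℕ, 1 ≤ t → ∃ C : ℝ, 0 < C ∧
      ∀ (V : Type) (_ : Fintype V) (_ : LinearOrder V) (G : SimpleGraph V)
        (A B : Finset V),
        (∀ a ∈ A, ∀ b ∈ B, a < b) →
        (∀ u v : V, G.Adj u v → (u ∈ A ∧ v ∈ B) ∨ (u ∈ B ∧ v ∈ A)) →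
        (¬ ∃ A' B' : Finset V, A' ⊆ A ∧ B' ⊆ B ∧ A'.card = t ∧ B'.card = t ∧
            ∀ a ∈ A', ∀ b ∈ B', DoubleCherry G a b) →
        (G.edgeSet.ncard : ℝ) ≤ C * (A.card + B.card) := by

  classical
  intro t ht
  refine ⟨t + 2 * (t * (t + 1)), by positivity, ?_⟩
  intro V _ _ G A B hAB hE hno
  let P : V → V → Prop := fun r v => ∃ x y, G.Adj v x ∧ G.Adj v y ∧ x ≤ r ∧ r ≤ y
  let Q : V → V → Prop := fun r v => ∃ x y, G.Adj r x ∧ G.Adj r y ∧ x ≤ v ∧ v ≤ y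
  have hA : ∀ a ∈ A, ∀ x, G.Adj a x → x ∈ B := by
    intro a ha x hx
    rcases hE a x hx with h | h
    · exact h.2
    · exact absurd (hAB a ha a h.1) (lt_irrefl _)
  have hB : ∀ b ∈ B, ∀ x, G.Adj b x → x ∈ A := by
    intro b hb x hx
    rcases hE b x hx with h | h
    · exact absurd (hAB b h.1 b hb) (lt_irrefl _)
    · exact h.2
  have hcore := dc_core A B P Q t ht
    (by
      rintro v x y z hxy hyz ⟨p, q, h1, h2, h3, h4⟩ ⟨p', q', h1', h2', h3', h4'⟩
      exact ⟨p, q', h1, h2', h3.trans hxy, hyz.trans h4'⟩)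
    (by
      rintro v x y z hxy hyz ⟨p, q, h1, h2, h3, h4⟩ ⟨p', q', h1', h2', h3', h4'⟩
      exact ⟨p, q', h1, h2', h3.trans hxy, hyz.trans h4'⟩)
    (by
      intro A' hA' B' hB' hcA hcB
      by_contra hcon
      push Not at hcon
      apply hno
      refine ⟨A', B', hA', hB', hcA, hcB, ?_⟩
      intro a ha b hb
      obtain ⟨⟨u₁, u₂, hu₁, hu₂, hl, hr⟩, v₁, v₂, hv₁, hv₂, hl', hr'⟩ := hcon a ha b hb
      by_cases hab : G.Adj a b
      · exact Or.inl hab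
      · right
        have n1 : u₁ ≠ a := by rintro rfl; exact hab hu₁.symm
        have n2 : a ≠ u₂ := by rintro rfl; exact hab hu₂.symm
        have n3 : v₁ ≠ b := by rintro rfl; exact hab hv₁
        have n4 : b ≠ v₂ := by rintro rfl; exact hab hv₂
        exact ⟨u₁, u₂, v₁, v₂, lt_of_le_of_ne hl n1, lt_of_le_of_ne hr n2,
          hAB _ (hB b (hB' hb) _ hu₂) _ (hA a (hA' ha) _ hv₁),
          lt_of_le_of_ne hl' n3, lt_of_le_of_ne hr' n4, hv₁, hv₂, hu₁, hu₂⟩)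
  set H := (A ×ˢ B).filter (fun p => P p.1 p.2 ∧ Q p.1 p.2) with hH
  have hsub : G.edgeSet ⊆ ((H.image (fun p => s(p.1, p.2)) : Finset (Sym2 V)) : Set (Sym2 V)) := by
    intro e
    induction e using Sym2.ind with
    | _ x y =>
      intro he
      rw [SimpleGraph.mem_edgeSet] at he
      have main : ∀ a ∈ A, ∀ b ∈ B, G.Adj a b → (a, b) ∈ H := by
        intro a ha b hb hab
        simp only [hH, Finset.mem_filter, Finset.mem_product]
        exact ⟨⟨ha, hb⟩, ⟨a, a, hab.symm, hab.symm, le_rfl, le_rfl⟩,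
          ⟨b, b, hab, hab, le_rfl, le_rfl⟩⟩
      rw [Finset.mem_coe, Finset.mem_image]
      rcases hE x y he with h | h
      · exact ⟨(x, y), main _ h.1 _ h.2 he, rfl⟩
      · exact ⟨(y, x), main _ h.2 _ h.1 he.symm, Sym2.eq_swap⟩
  have hcard : G.edgeSet.ncard ≤ t * A.card + 2 * B.card * (t * (t + 1)) := by
    refine (Set.ncard_le_ncard hsub (Finset.finite_toSet _)).trans ?_
    rw [Set.ncard_coe_finset]
    refine Finset.card_image_le.trans ?_
    exact le_of_eq_of_le (by rw [hH]; congr) hcore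
  have hR : (G.edgeSet.ncard : ℝ) ≤ t * A.card + 2 * B.card * (t * (t + 1)) := by
    exact_mod_cast hcard
  have p1 : (0 : ℝ) ≤ 2 * (t * (t + 1)) * A.card := by positivity
  have p2 : (0 : ℝ) ≤ t * B.card := by positivity
  nlinarith
end

section
/- For every integer t ≥ 1 there is a constant C_t > 0 such that the following holds. Let G = (V,E) be a finite ordered graph on n vertices. If G does not contain two disjoint t-element vertex subsets S and T such that every vertex of S and every vertex of T form a double cherry, then G has at most C_t · n · log(n+1) edges. -/
/-- Two (not necessarily ordered) vertices form a double cherry if the smaller and the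
larger of them do. -/
def DoubleCherryPair {V : Type*} [LinearOrder V] (G : SimpleGraph V) (u v : V) : Prop :=
  DoubleCherry G (min u v) (max u v)

namespace DC

open Finset

/-- `k`-rank bound: elements near the top. -/
lemma low_card (A : Finset ℕ) (w t : ℕ) :
    #{v ∈ A | v ≤ w ∧ #{x ∈ A | v ≤ x ∧ x ≤ w} ≤ t} ≤ t := by
  set F := {v ∈ A | v ≤ w ∧ #{x ∈ A | v ≤ x ∧ x ≤ w} ≤ t} with hF
  rcases F.eq_empty_or_nonempty with h | h
  · simp [h]
  · have hm := F.min'_mem h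
    have h2 := (mem_filter.1 hm).2.2
    refine le_trans (card_le_card ?_) h2
    intro x hx
    have := F.min'_le x hx
    have hx' := mem_filter.1 hx
    simp only [mem_filter]
    exact ⟨hx'.1, this, hx'.2.1⟩

lemma up_card (A : Finset ℕ) (t : ℕ) :
    #{v ∈ A | #{x ∈ A | v ≤ x} < t} ≤ t := by
  set F := {v ∈ A | #{x ∈ A | v ≤ x} < t} with hF
  rcases F.eq_empty_or_nonempty with h | h
  · simp [h]
  · have hm := F.min'_mem h
    have h2 := (mem_filter.1 hm).2
    refine le_trans (card_le_card ?_) h2.le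
    intro x hx
    have := F.min'_le x hx
    have hx' := mem_filter.1 hx
    simp only [mem_filter]
    exact ⟨hx'.1, this⟩

/-- active columns -/
def act (C : Finset ℕ) (bot top : ℕ → ℕ) (y : ℕ) : Finset ℕ :=
  {v ∈ C | bot v ≤ y ∧ y ≤ top v}

/-- window -/
def win (A : Finset ℕ) (t v : ℕ) : Finset ℕ :=
  {w ∈ A | v ≤ w ∧ #{x ∈ A | v ≤ x ∧ x ≤ w} ≤ t}

lemma win_card (A : Finset ℕ) (t v : ℕ) (h : t ≤ #{x ∈ A | v ≤ x}) : t ≤ #(win A t v) := by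
  by_cases hF : ∀ x ∈ A, v ≤ x → x ∈ win A t v
  · refine h.trans (card_le_card ?_)
    intro x hx
    exact hF x (mem_filter.1 hx).1 (mem_filter.1 hx).2
  · push Not at hF
    set D := {x ∈ A | v ≤ x ∧ x ∉ win A t v} with hD
    have hne : D.Nonempty := by
      obtain ⟨x, h1, h2, h3⟩ := hF
      exact ⟨x, mem_filter.2 ⟨h1, h2, h3⟩⟩
    have hm := mem_filter.1 (D.min'_mem hne)
    set m := D.min' hne with hmdef
    have hr : t < #{x ∈ A | v ≤ x ∧ x ≤ m} := by
      by_contra hc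
      exact hm.2.2 (mem_filter.2 ⟨hm.1, hm.2.1, not_lt.1 hc⟩)
    have hsub : {x ∈ A | v ≤ x ∧ x ≤ m} ⊆ insert m (win A t v) := by
      intro x hx
      obtain ⟨h1, h2, h3⟩ := mem_filter.1 hx
      by_cases hxw : x ∈ win A t v
      · exact mem_insert_of_mem hxw
      · have := D.min'_le x (mem_filter.2 ⟨h1, h2, hxw⟩)
        have : x = m := le_antisymm h3 this
        simp [this]
    have := (card_le_card hsub).trans (card_insert_le _ _)
    omega

lemma win_sub (A B : Finset ℕ) (t v : ℕ) (h1 : win A t v ⊆ B) (h2 : win B t v ⊆ A) :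
    win A t v ⊆ win B t v := by
  intro w hw
  by_contra hc
  obtain ⟨ha, hv, hr⟩ := mem_filter.1 hw
  have hb := h1 hw
  have hrb : t < #{x ∈ B | v ≤ x ∧ x ≤ w} := by
    by_contra hcc
    exact hc (mem_filter.2 ⟨hb, hv, not_lt.1 hcc⟩)
  have hcard : t ≤ #(win B t v) := by
    apply win_card
    refine hrb.le.trans (card_le_card ?_)
    intro x hx
    obtain ⟨h1, h2, h3⟩ := mem_filter.1 hx
    exact mem_filter.2 ⟨h1, h2⟩
  have hsub : insert w (win B t v) ⊆ {x ∈ A | v ≤ x ∧ x ≤ w} := by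
    intro x hx
    rcases mem_insert.1 hx with rfl | hx
    · exact mem_filter.2 ⟨ha, hv, le_rfl⟩
    · obtain ⟨k1, k2, k3⟩ := mem_filter.1 hx
      refine mem_filter.2 ⟨h2 hx, k2, ?_⟩
      by_contra hlt
      have : #{x ∈ B | v ≤ x ∧ x ≤ w} ≤ #{z ∈ B | v ≤ z ∧ z ≤ x} := by
        apply card_le_card
        intro z hz
        obtain ⟨l1, l2, l3⟩ := mem_filter.1 hz
        exact mem_filter.2 ⟨l1, l2, by omega⟩
      omega
  have := card_le_card hsub
  rw [card_insert_of_notMem hc] at this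
  omega

/-- pairs charged to the event height `f w` -/
def Q (C : Finset ℕ) (bot top : ℕ → ℕ) (t : ℕ) (f : ℕ → ℕ) : Finset (ℕ × ℕ) :=
  C.biUnion fun w =>
    ({v ∈ act C bot top (f w) | v ≤ w ∧ #{x ∈ act C bot top (f w) | v ≤ x ∧ x ≤ w} ≤ t}).image
      fun v => (v, w)

lemma Q_card (C : Finset ℕ) (bot top : ℕ → ℕ) (t : ℕ) (f : ℕ → ℕ) :
    #(Q C bot top t f) ≤ #C * t := by
  apply card_biUnion_le_card_mul
  intro w _
  exact card_image_le.trans (low_card _ _ _)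

lemma mem_Q {C : Finset ℕ} {bot top : ℕ → ℕ} {t : ℕ} {f : ℕ → ℕ} {v w : ℕ}
    (hv : v ∈ act C bot top (f w)) (hw : w ∈ win (act C bot top (f w)) t v) :
    (v, w) ∈ Q C bot top t f := by
  obtain ⟨h1, h2, h3⟩ := mem_filter.1 hw
  refine mem_biUnion.2 ⟨w, (mem_filter.1 h1).1, mem_image.2 ⟨v, ?_, rfl⟩⟩
  exact mem_filter.2 ⟨hv, h2, h3⟩

/-- the target set of windows -/
def P (C : Finset ℕ) (bot top : ℕ → ℕ) (t : ℕ) : Finset (ℕ × Finset ℕ) :=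
  (Q C bot top t top).image (fun p => (p.1, win (act C bot top (top p.2)) t p.1)) ∪
  (Q C bot top t bot).image (fun p => (p.1, win (act C bot top (bot p.2 - 1)) t p.1))

lemma P_card (C : Finset ℕ) (bot top : ℕ → ℕ) (t : ℕ) :
    #(P C bot top t) ≤ 2 * t * #C := by
  refine (card_union_le _ _).trans ?_
  have h1 := Q_card C bot top t top
  have h2 := Q_card C bot top t bot
  refine (Nat.add_le_add (card_image_le.trans h1) (card_image_le.trans h2)).trans ?_
  nlinarith

lemma mem_P (C : Finset ℕ) (bot top : ℕ → ℕ) (t : ℕ) (ht : 1 ≤ t) (v : ℕ) :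
    ∀ d y, top v - y = d → v ∈ act C bot top y → (v, win (act C bot top y) t v) ∈ P C bot top t := by
  intro d
  induction d with
  | zero =>
    intro y hd hv
    obtain ⟨h1, h2, h3⟩ := mem_filter.1 hv
    have hy : y = top v := by omega
    subst hy
    refine mem_union_left _ (mem_image.2 ⟨(v, v), mem_Q hv ?_, rfl⟩)
    refine mem_filter.2 ⟨hv, le_rfl, ?_⟩
    refine le_trans (card_le_card (t := {v}) ?_) (by simpa using ht)
    intro x hx
    have := (mem_filter.1 hx).2
    simp; omega
  | succ d ih =>
    intro y hd hv
    obtain ⟨h1, h2, h3⟩ := mem_filter.1 hv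
    have hv' : v ∈ act C bot top (y+1) := mem_filter.2 ⟨h1, by omega, by omega⟩
    by_cases ha : win (act C bot top y) t v ⊆ act C bot top (y+1)
    · by_cases hb : win (act C bot top (y+1)) t v ⊆ act C bot top y
      · have heq := Subset.antisymm (win_sub _ _ t v ha hb) (win_sub _ _ t v hb ha)
        rw [heq]
        exact ih (y+1) (by omega) hv'
      · obtain ⟨w, hw, hn⟩ := not_subset.1 hb
        have hw1 := mem_filter.1 (mem_filter.1 hw).1
        have hbw : bot w = y + 1 := by
          by_contra hc
          exact hn (mem_filter.2 ⟨hw1.1, by omega, by omega⟩)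
        refine mem_union_right _ (mem_image.2 ⟨(v, w), mem_Q ?_ ?_, ?_⟩)
        · rw [hbw]; exact hv'
        · rw [hbw]; exact hw
        · simp [hbw]
    · obtain ⟨w, hw, hn⟩ := not_subset.1 ha
      have hw1 := mem_filter.1 (mem_filter.1 hw).1
      have hbw : top w = y := by
        by_contra hc
        exact hn (mem_filter.2 ⟨hw1.1, by omega, by omega⟩)
      refine mem_union_left _ (mem_image.2 ⟨(v, w), mem_Q ?_ ?_, ?_⟩)
      · rw [hbw]; exact hv
      · rw [hbw]; exact hw
      · simp [hbw]

/-- crossing -/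
def Cross (E : Finset (ℕ × ℕ)) (u v : ℕ) : Prop :=
  ∃ u₁ u₂ v₁ v₂, u₁ ≤ u ∧ u ≤ u₂ ∧ v₁ ≤ v ∧ v ≤ v₂ ∧
    (u, v₁) ∈ E ∧ (u, v₂) ∈ E ∧ (u₁, v) ∈ E ∧ (u₂, v) ∈ E

lemma matrix_bound (E : Finset (ℕ × ℕ)) (R C : Finset ℕ) (hR : ∀ p ∈ E, p.1 ∈ R)
    (hC : ∀ p ∈ E, p.2 ∈ C) (t : ℕ) (ht : 1 ≤ t)
    (hno : ¬ ∃ S T : Finset ℕ, S ⊆ R ∧ T ⊆ C ∧ #S = t ∧ #T = t ∧ ∀ u ∈ S, ∀ v ∈ T, Cross E u v) :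
    #E ≤ t * #R + t * (2 * t * #C) := by
  classical
  set row : ℕ → Finset ℕ := fun u => {v ∈ C | (u, v) ∈ E} with hrow
  set col : ℕ → Finset ℕ := fun v => {u ∈ R | (u, v) ∈ E} with hcol
  set C' := {v ∈ C | (col v).Nonempty} with hC'
  set top : ℕ → ℕ := fun v => if h : (col v).Nonempty then (col v).max' h else 0 with htop
  set bot : ℕ → ℕ := fun v => if h : (col v).Nonempty then (col v).min' h else 0 with hbot
  have hmemcol : ∀ {u v}, (u, v) ∈ E → u ∈ col v := fun {u v} h => mem_filter.2 ⟨hR _ h, h⟩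
  have hact : ∀ {u v}, (u, v) ∈ E → v ∈ act C' bot top u := by
    intro u v h
    have hu := hmemcol h
    have hne : (col v).Nonempty := ⟨u, hu⟩
    refine mem_filter.2 ⟨mem_filter.2 ⟨hC _ h, hne⟩, ?_, ?_⟩
    · simp only [hbot, hne, dite_true]; exact min'_le _ _ hu
    · simp only [htop, hne, dite_true]; exact le_max' _ _ hu
  have hact2 : ∀ {u v}, v ∈ act C' bot top u →
      ∃ u₁ u₂, u₁ ≤ u ∧ u ≤ u₂ ∧ (u₁, v) ∈ E ∧ (u₂, v) ∈ E := by
    intro u v h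
    obtain ⟨h1, h2, h3⟩ := mem_filter.1 h
    have hne := (mem_filter.1 h1).2
    simp only [hbot, htop, hne, dite_true] at h2 h3
    exact ⟨_, _, h2, h3, (mem_filter.1 (min'_mem _ hne)).2, (mem_filter.1 (max'_mem _ hne)).2⟩
  set bad := {p ∈ E | #{x ∈ row p.1 | p.2 ≤ x} < t} with hbad
  set good := {p ∈ E | ¬ #{x ∈ row p.1 | p.2 ≤ x} < t} with hgood
  have hsum : #bad + #good = #E := card_filter_add_card_filter_not _
  have hb : #bad ≤ t * #R := by
    apply card_le_mul_card_image_of_maps_to (f := Prod.fst)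
    · intro p hp; exact hR _ (mem_filter.1 hp).1
    · intro u hu
      refine le_trans ?_ (up_card (row u) t)
      apply card_le_card_of_injOn Prod.snd
      · intro p hp
        obtain ⟨hp1, rfl⟩ := mem_filter.1 hp
        obtain ⟨hp2, hp3⟩ := mem_filter.1 hp1
        exact mem_filter.2 ⟨mem_filter.2 ⟨hC _ hp2, hp2⟩, hp3⟩
      · intro p hp q hq h
        exact Prod.ext ((mem_filter.1 hp).2.trans (mem_filter.1 hq).2.symm) h
  have hg : #good ≤ t * #(P C' bot top t) := by
    apply card_le_mul_card_image_of_maps_to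
      (f := fun p => (p.2, win (act C' bot top p.1) t p.2))
    · intro p hp
      exact mem_P C' bot top t ht p.2 _ p.1 rfl (hact (mem_filter.1 hp).1)
    · rintro ⟨v, W⟩ _
      by_contra hlt
      push Not at hlt
      set F := {p ∈ good | (fun p : ℕ × ℕ => (p.2, win (act C' bot top p.1) t p.2)) p = (v, W)} with hF
      have hFm : ∀ p ∈ F, p ∈ E ∧ t ≤ #{x ∈ row p.1 | p.2 ≤ x} ∧ p.2 = v ∧
          win (act C' bot top p.1) t v = W := by
        intro p hp
        obtain ⟨h1, h2⟩ := mem_filter.1 hp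
        obtain ⟨h3, h4⟩ := mem_filter.1 h1
        simp only [Prod.mk.injEq] at h2
        obtain ⟨h5, h6⟩ := h2
        rw [h5] at h6
        exact ⟨h3, not_lt.1 h4, h5, h6⟩
      have hinj : #(F.image Prod.fst) = #F := by
        apply card_image_of_injOn
        intro p hp q hq h
        exact Prod.ext h ((hFm p hp).2.2.1.trans (hFm q hq).2.2.1.symm)
      obtain ⟨S, hS, hSc⟩ := exists_subset_card_eq (hinj ▸ hlt.le)
      have hrowact : ∀ u, row u ⊆ act C' bot top u := fun u x hx => hact (mem_filter.1 hx).2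
      have hW : t ≤ #W := by
        have : F.Nonempty := card_pos.1 (by omega)
        obtain ⟨p, hp⟩ := this
        obtain ⟨h1, h2, h3, h4⟩ := hFm p hp
        rw [← h4]
        apply win_card
        rw [h3] at h2
        exact h2.trans (card_le_card (filter_subset_filter _ (hrowact _)))
      obtain ⟨T, hT, hTc⟩ := exists_subset_card_eq hW
      have key : ∀ u ∈ S, ∀ w ∈ T, w ∈ C ∧ Cross E u w ∧ u ∈ R := by
        intro u hu w hw
        obtain ⟨p, hp, rfl⟩ := mem_image.1 (hS hu)
        obtain ⟨h1, h2, h3, h4⟩ := hFm p hp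
        have hwW := hT hw
        rw [← h4] at hwW
        obtain ⟨k1, k2, k3⟩ := mem_filter.1 hwW
        obtain ⟨u₁, u₂, l1, l2, l3, l4⟩ := hact2 k1
        have hv2 : ∃ v₂, w ≤ v₂ ∧ (p.1, v₂) ∈ E := by
          by_contra hc
          push Not at hc
          have hsub : insert w {x ∈ row p.1 | p.2 ≤ x} ⊆
              {x ∈ act C' bot top p.1 | v ≤ x ∧ x ≤ w} := by
            intro x hx
            rcases mem_insert.1 hx with rfl | hx
            · exact mem_filter.2 ⟨k1, k2, le_rfl⟩
            · obtain ⟨m1, m2⟩ := mem_filter.1 hx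
              refine mem_filter.2 ⟨hrowact _ m1, h3 ▸ m2, ?_⟩
              by_contra hxw
              exact hc x (by omega) (mem_filter.1 m1).2
          have := card_le_card hsub
          rw [card_insert_of_notMem] at this
          · omega
          · intro hwm
            exact hc w le_rfl (mem_filter.1 (mem_filter.1 hwm).1).2
        obtain ⟨v₂, m1, m2⟩ := hv2
        refine ⟨hC _ l3, ⟨u₁, u₂, v, v₂, l1, l2, k2, m1, ?_, m2, l3, l4⟩, hR _ h1⟩
        rw [← h3]; exact h1
      apply hno
      have hSne : S.Nonempty := card_pos.1 (by omega)
      have hTne : T.Nonempty := card_pos.1 (by omega)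
      obtain ⟨u0, hu0⟩ := hSne
      obtain ⟨w0, hw0⟩ := hTne
      exact ⟨S, T, fun u hu => (key u hu w0 hw0).2.2, fun w hw => (key u0 hu0 w hw).1, hSc, hTc,
        fun u hu w hw => (key u hu w hw).2.1⟩
  have hPc : #(P C' bot top t) ≤ 2 * t * #C :=
    (P_card _ _ _ _).trans (Nat.mul_le_mul_left _ (card_le_card (filter_subset _ _)))
  have := Nat.mul_le_mul_left t hPc
  omega

/-- edges inside `[a, a+m)` -/
def ed (E : Finset (ℕ × ℕ)) (a m : ℕ) : Finset (ℕ × ℕ) :=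
  {p ∈ E | a ≤ p.1 ∧ p.1 < p.2 ∧ p.2 < a + m}

/-- crossing edges -/
def ce (E : Finset (ℕ × ℕ)) (a b c : ℕ) : Finset (ℕ × ℕ) :=
  {p ∈ E | a ≤ p.1 ∧ p.1 < b ∧ b ≤ p.2 ∧ p.2 < c}

lemma divide (E : Finset (ℕ × ℕ)) (K : ℕ)
    (hK : ∀ a h l, #(ce E a (a+h) (a+h+l)) ≤ K * (h + l)) :
    ∀ k a m, m ≤ 2 ^ k → #(ed E a m) ≤ K * m * k := by
  intro k
  induction k with
  | zero =>
    intro a m hm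
    have : ed E a m = ∅ := by
      apply filter_eq_empty_iff.2
      intro p _ hp
      simp at hm
      omega
    simp [this]
  | succ k ih =>
    intro a m hm
    rw [pow_succ] at hm
    obtain ⟨h, l, rfl, hh, hl⟩ : ∃ h l, m = h + l ∧ h ≤ 2 ^ k ∧ l ≤ 2 ^ k :=
      ⟨m / 2, m - m / 2, by omega, by omega, by omega⟩
    have hsub : ed E a (h + l) ⊆ (ed E a h ∪ ed E (a+h) l) ∪ ce E a (a+h) (a+h+l) := by
      intro p hp
      simp only [ed, ce, mem_union, mem_filter] at hp ⊢
      obtain ⟨h1, h2, h3, h4⟩ := hp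
      simp only [h1, true_and]
      omega
    have h1 := (card_le_card hsub).trans (card_union_le _ _)
    have h2 := card_union_le (ed E a h) (ed E (a+h) l)
    have h3 := ih a h hh
    have h4 := ih (a+h) l hl
    have h5 := hK a h l
    calc _ ≤ K * h * k + K * l * k + K * (h+l) := by omega
      _ = _ := by ring

lemma log_bound (n : ℕ) (hn : 1 ≤ n) :
    ((Nat.log 2 n + 1 : ℕ) : ℝ) ≤ 4 * Real.log (n + 1) := by
  have h2 : (0.6931471803 : ℝ) < Real.log 2 := Real.log_two_gt_d9
  have hpow : 2 ^ (Nat.log 2 n) ≤ n := Nat.pow_log_le_self 2 (by omega)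
  have hn' : (1 : ℝ) ≤ n := by exact_mod_cast hn
  have h3 : (Nat.log 2 n : ℝ) * Real.log 2 ≤ Real.log (n + 1) := by
    rw [← Real.log_pow]
    apply Real.log_le_log (by positivity)
    have : ((2 ^ (Nat.log 2 n) : ℕ) : ℝ) ≤ n := by exact_mod_cast hpow
    push_cast at this
    linarith
  have h4 : Real.log 2 ≤ Real.log (n + 1) := Real.log_le_log (by norm_num) (by linarith)
  have h5 : (0:ℝ) ≤ Nat.log 2 n := by positivity
  push_cast
  nlinarith

lemma fin_main (t : ℕ) (ht : 1 ≤ t) (n : ℕ) (V : Type) [Fintype V] [LinearOrder V]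
    (e : V ≃o Fin n) (G : SimpleGraph V)
    (hno : ¬ ∃ S T : Finset V, Disjoint S T ∧ S.card = t ∧ T.card = t ∧
            ∀ u ∈ S, ∀ v ∈ T, DoubleCherryPair G u v) :
    G.edgeSet.ncard ≤ (t + 2 * t * t) * n * (Nat.log 2 n + 1) := by
  classical
  set g : V → ℕ := fun v => (e v : ℕ) with hg
  have hglt : ∀ x y, g x < g y ↔ x < y := by
    intro x y; simp [hg]
  have hginj : Function.Injective g := fun x y h => e.injective (Fin.ext h)
  have hgn : ∀ x, g x < n := fun x => (e x).2
  set E : Finset (ℕ × ℕ) :=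
    ({p : V × V | G.Adj p.1 p.2 ∧ p.1 < p.2} : Finset (V × V)).image (fun p => (g p.1, g p.2)) with hE
  have hEm : ∀ {p : ℕ × ℕ}, p ∈ E → ∃ x y, G.Adj x y ∧ x < y ∧ g x = p.1 ∧ g y = p.2 := by
    intro p hp
    obtain ⟨⟨x, y⟩, h1, rfl⟩ := mem_image.1 hp
    simp at h1
    exact ⟨x, y, h1.1, h1.2, rfl, rfl⟩
  have hEa : ∀ {x y}, (g x, g y) ∈ E → G.Adj x y := by
    intro x y h
    obtain ⟨x', y', h1, h2, h3, h4⟩ := hEm h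
    rw [← hginj h3, ← hginj h4]; exact h1
  have hcard : G.edgeSet.ncard ≤ #E := by
    have hEc : #E = #({p : V × V | G.Adj p.1 p.2 ∧ p.1 < p.2} : Finset (V × V)) := by
      apply card_image_of_injective
      rintro ⟨a, b⟩ ⟨c, d⟩ h
      simp only [Prod.mk.injEq] at h
      exact Prod.ext (hginj h.1) (hginj h.2)
    rw [hEc]
    have hsub : G.edgeSet ⊆ ((({p : V × V | G.Adj p.1 p.2 ∧ p.1 < p.2} : Finset (V × V)).image
        (fun p => s(p.1, p.2)) : Finset (Sym2 V)) : Set (Sym2 V)) := by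
      intro s
      induction s with
      | _ x y =>
        intro h
        have h' : G.Adj x y := h
        rcases lt_or_gt_of_ne h'.ne with hl | hl
        · exact mem_coe.2 (mem_image.2 ⟨(x, y), by simp [h', hl], rfl⟩)
        · exact mem_coe.2 (mem_image.2 ⟨(y, x), by simp [h'.symm, hl], Sym2.eq_swap⟩)
    have := Set.ncard_le_ncard hsub (finite_toSet _)
    rw [Set.ncard_coe_finset] at this
    exact this.trans card_image_le
  have hK : ∀ a h l, #(ce E a (a+h) (a+h+l)) ≤ (t + 2 * t * t) * (h + l) := by
    intro a h l
    have := matrix_bound (ce E a (a+h) (a+h+l)) (Ico a (a+h)) (Ico (a+h) (a+h+l))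
      (by intro p hp
          have := (mem_filter.1 hp).2
          exact mem_Ico.2 ⟨this.1, this.2.1⟩)
      (by intro p hp
          have := (mem_filter.1 hp).2
          exact mem_Ico.2 ⟨this.2.2.1, this.2.2.2⟩) t ht ?_
    · simp only [Nat.card_Ico, Nat.add_sub_cancel_left] at this
      nlinarith [Nat.zero_le (t * l), Nat.zero_le (t * t * h)]
    · rintro ⟨S, T, hS, hT, hSc, hTc, hX⟩
      apply hno
      have hSne : S.Nonempty := card_pos.1 (by omega)
      have hTne : T.Nonempty := card_pos.1 (by omega)
      have hcE : ∀ {p}, p ∈ ce E a (a+h) (a+h+l) → p ∈ E := fun hp => (mem_filter.1 hp).1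
      have hSr : ∀ u ∈ S, u ∈ Set.range g := by
        intro u hu
        obtain ⟨w, hw⟩ := hTne
        obtain ⟨u₁, u₂, v₁, v₂, h1, h2, h3, h4, h5, h6, h7, h8⟩ := hX u hu w hw
        obtain ⟨x, y, -, -, hx, -⟩ := hEm (hcE h5)
        exact ⟨x, hx⟩
      have hTr : ∀ u ∈ T, u ∈ Set.range g := by
        intro w hw
        obtain ⟨u, hu⟩ := hSne
        obtain ⟨u₁, u₂, v₁, v₂, h1, h2, h3, h4, h5, h6, h7, h8⟩ := hX u hu w hw
        obtain ⟨x, y, -, -, -, hx⟩ := hEm (hcE h7)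
        exact ⟨y, hx⟩
      have hpre : ∀ S : Finset ℕ, (∀ u ∈ S, u ∈ Set.range g) →
          #(S.preimage g hginj.injOn) = #S := by
        intro S hS
        rw [card_preimage]
        congr 1
        exact filter_true_of_mem hS
      refine ⟨S.preimage g hginj.injOn, T.preimage g hginj.injOn, ?_, ?_, ?_, ?_⟩
      · rw [disjoint_left]
        intro x hx hy
        have h1 := mem_Ico.1 (hS (mem_preimage.1 hx))
        have h2 := mem_Ico.1 (hT (mem_preimage.1 hy))
        omega
      · rw [hpre S hSr, hSc]
      · rw [hpre T hTr, hTc]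
      · intro u hu v hv
        have hu' := mem_preimage.1 hu
        have hv' := mem_preimage.1 hv
        have k1 := mem_Ico.1 (hS hu')
        have k2 := mem_Ico.1 (hT hv')
        have huv : u < v := (hglt u v).1 (by omega)
        unfold DoubleCherryPair
        rw [min_eq_left huv.le, max_eq_right huv.le]
        by_cases hadj : G.Adj u v
        · exact Or.inl hadj
        right
        have hnE : (g u, g v) ∉ E := fun hc => hadj (hEa hc)
        obtain ⟨u₁, u₂, v₁, v₂, h1, h2, h3, h4, h5, h6, h7, h8⟩ := hX _ hu' _ hv'
        have q5 := (mem_filter.1 h5).2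
        have q8 := (mem_filter.1 h8).2
        obtain ⟨-, y1, -, -, -, e1⟩ := hEm (hcE h5)
        obtain ⟨-, y2, -, -, -, e2⟩ := hEm (hcE h6)
        obtain ⟨x1, -, -, -, e3, -⟩ := hEm (hcE h7)
        obtain ⟨x2, -, -, -, e4, -⟩ := hEm (hcE h8)
        simp only at e1 e2 e3 e4 q5 q8
        subst e1 e2 e3 e4
        have n1 : g y1 ≠ g v := fun hc => hnE (hc ▸ hcE h5)
        have n2 : g y2 ≠ g v := fun hc => hnE (hc ▸ hcE h6)
        have n3 : g x1 ≠ g u := fun hc => hnE (hc ▸ hcE h7)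
        have n4 : g x2 ≠ g u := fun hc => hnE (hc ▸ hcE h8)
        refine ⟨x1, x2, y1, y2, ?_, ?_, ?_, ?_, ?_, hEa (hcE h5), hEa (hcE h6),
          (hEa (hcE h7)).symm, (hEa (hcE h8)).symm⟩ <;> rw [← hglt] <;> omega
  have hfin := divide E _ hK (Nat.log 2 n + 1) 0 n (Nat.lt_pow_succ_log_self (by norm_num) n).le
  have hEd : ed E 0 n = E := by
    apply filter_true_of_mem
    intro p hp
    obtain ⟨x, y, h1, h2, h3, h4⟩ := hEm hp
    have := (hglt x y).2 h2
    have := hgn y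
    omega
  rw [hEd] at hfin
  exact hcard.trans hfin

end DC

/-- For every `t ≥ 1` there is a constant `C > 0` such that every finite ordered graph
on `n` vertices without two disjoint `t`-element vertex subsets, every two vertices from
different subsets forming a double cherry, has at most `C·n·log(n+1)` edges. -/
theorem double_cherry_ordered_ub :
    ∀ t : ℕ, 1 ≤ t → ∃ C : ℝ, 0 < C ∧
      ∀ (V : Type) (_ : Fintype V) (_ : LinearOrder V) (G : SimpleGraph V),
        (¬ ∃ S T : Finset V, Disjoint S T ∧ S.card = t ∧ T.card = t ∧
            ∀ u ∈ S, ∀ v ∈ T, DoubleCherryPair G u v) →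
        (G.edgeSet.ncard : ℝ) ≤ C * (Fintype.card V) * Real.log (Fintype.card V + 1) := by
  intro t ht
  refine ⟨((t + 2 * t * t : ℕ) : ℝ) * 4, by positivity, ?_⟩
  intro V _ _ G hno
  have h := DC.fin_main t ht (Fintype.card V) V (Fintype.orderIsoFinOfCardEq V rfl).symm G hno
  have h' : (G.edgeSet.ncard : ℝ) ≤
      ((t + 2 * t * t : ℕ) : ℝ) * (Fintype.card V) * ((Nat.log 2 (Fintype.card V) + 1 : ℕ) : ℝ) := by
    exact_mod_cast h
  rcases Nat.eq_zero_or_pos (Fintype.card V) with h0 | h0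
  · rw [h0] at h' ⊢
    simpa using h'
  · refine h'.trans ?_
    have hl := DC.log_bound _ h0
    calc _ ≤ ((t + 2 * t * t : ℕ) : ℝ) * (Fintype.card V) * (4 * Real.log (Fintype.card V + 1)) := by
          gcongr
      _ = _ := by ring
end

section
/- For every integer t ≥ 1 there is a constant C_t > 0 such that the following holds. Let G be a cyclically-ordered graph on Fin n that is bipartite with bipartition V = A ∪ B, where there is a rotation of Fin n under which every element of A precedes every element of B, and all edges of G join A to B. If G does not contain two disjoint t-element vertex subsets S and T such that every vertex of S and every vertex of T form a double cherry, then G has at most C_t · n edges. -/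
/-- In a cyclically-ordered graph `G` on `Fin n`, two vertices `u` and `v` form a double
cherry if either `uv` is an edge of `G`, or there exist vertices `u₁, u₂, v₁, v₂` such
that `u₁, u, u₂, v₁, v, v₂` appear in this cyclic order and `uv₁`, `uv₂`, `vu₁`, `vu₂`
are all edges of `G`. -/
def CyclicDoubleCherry {n : ℕ} (G : SimpleGraph (Fin n)) (u v : Fin n) : Prop :=
  G.Adj u v ∨ ∃ u₁ u₂ v₁ v₂ : Fin n,
    FinCyclicSorted [u₁, u, u₂, v₁, v, v₂] ∧
    G.Adj u v₁ ∧ G.Adj u v₂ ∧ G.Adj v u₁ ∧ G.Adj v u₂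

namespace DCB

open Finset

/-- column `b` is active at height `a` -/
def act (E : Finset (ℕ × ℕ)) (a b : ℕ) : Prop :=
  (∃ a₁ ≤ a, (a₁, b) ∈ E) ∧ (∃ a₂ ≥ a, (a₂, b) ∈ E)

/-- row `a` spans `b` -/
def rowAct (E : Finset (ℕ × ℕ)) (a b : ℕ) : Prop :=
  (∃ b₁ ≤ b, (a, b₁) ∈ E) ∧ (∃ b₂ ≥ b, (a, b₂) ∈ E)

/-- `W` is convex in the set `P` and of size `t` -/
def Win (P : ℕ → Prop) (t : ℕ) (W : Finset ℕ) : Prop :=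
  W.card = t ∧ (∀ w ∈ W, P w) ∧ ∀ x, P x → ∀ w₁ ∈ W, ∀ w₂ ∈ W, w₁ ≤ x → x ≤ w₂ → x ∈ W

lemma seg_eq (X Y : Finset ℕ) (hc : X.card = Y.card)
    (h : ∀ x ∈ X, ∀ y ∈ Y, (x ≤ y → y ∈ X) ∧ (y ≤ x → x ∈ Y)) : X = Y := by
  have : X ⊆ Y := by
    intro x hx
    by_contra hxY
    have hs : Y ⊂ X := by
      refine ⟨fun y hy => ?_, fun hh => hxY (hh hx)⟩
      rcases le_total x y with h1 | h1
      · exact (h x hx y hy).1 h1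
      · exact absurd ((h x hx y hy).2 h1) hxY
    have := Finset.card_lt_card hs
    omega
  exact Finset.eq_of_subset_of_card_le this hc.ge

lemma seg_eq' (X Y : Finset ℕ) (hc : X.card = Y.card)
    (h : ∀ x ∈ X, ∀ y ∈ Y, (y ≤ x → y ∈ X) ∧ (x ≤ y → x ∈ Y)) : X = Y := by
  have : X ⊆ Y := by
    intro x hx
    by_contra hxY
    have hs : Y ⊂ X := by
      refine ⟨fun y hy => ?_, fun hh => hxY (hh hx)⟩
      rcases le_total y x with h1 | h1
      · exact (h x hx y hy).1 h1
      · exact absurd ((h x hx y hy).2 h1) hxY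
    have := Finset.card_lt_card hs
    omega
  exact Finset.eq_of_subset_of_card_le this hc.ge

lemma win_inj (P : ℕ → Prop) (t v : ℕ) (W W' : Finset ℕ) (h : Win P t W) (h' : Win P t W')
    (s : (∃ w ∈ W, w ≤ v) ∧ (∃ w ∈ W, v ≤ w)) (s' : (∃ w ∈ W', w ≤ v) ∧ (∃ w ∈ W', v ≤ w))
    (hc : (W.filter (· < v)).card = (W'.filter (· < v)).card) : W = W' := by
  obtain ⟨⟨p, hp, hpv⟩, ⟨q, hq, hqv⟩⟩ := s
  obtain ⟨⟨p', hp', hpv'⟩, ⟨q', hq', hqv'⟩⟩ := s'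
  obtain ⟨c, hP, hW⟩ := h
  obtain ⟨c', hP', hW'⟩ := h'
  have e1 : W.filter (· < v) = W'.filter (· < v) := by
    apply seg_eq _ _ hc
    intro x hx y hy
    simp only [mem_filter] at hx hy ⊢
    exact ⟨fun hh => ⟨hW y (hP' y hy.1) x hx.1 q hq hh (by omega), hy.2⟩,
      fun hh => ⟨hW' x (hP x hx.1) y hy.1 q' hq' hh (by omega), hx.2⟩⟩
  have e2 : W.filter (fun x => ¬ x < v) = W'.filter (fun x => ¬ x < v) := by
    apply seg_eq'
    · have := Finset.card_filter_add_card_filter_not (s := W) (· < v)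
      have := Finset.card_filter_add_card_filter_not (s := W') (· < v)
      omega
    intro x hx y hy
    simp only [mem_filter] at hx hy ⊢
    exact ⟨fun hh => ⟨hW y (hP' y hy.1) p hp x hx.1 (by omega) hh, hy.2⟩,
      fun hh => ⟨hW' x (hP x hx.1) p' hp' y hy.1 (by omega) hh, hx.2⟩⟩
  rw [← Finset.filter_union_filter_not_eq (· < v) W, e1, e2,
    Finset.filter_union_filter_not_eq (· < v) W']

lemma win_card (P : ℕ → Prop) (t v : ℕ) (F : Finset (Finset ℕ))
    (hF : ∀ W ∈ F, Win P t W ∧ (∃ w ∈ W, w ≤ v) ∧ (∃ w ∈ W, v ≤ w)) : F.card ≤ t + 1 := by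
  have := Finset.card_le_card_of_injOn (s := F) (t := range (t+1))
    (fun W => (W.filter (· < v)).card) ?_ ?_
  · simpa using this
  · intro W hW
    have h1 := (hF W hW).1.1
    have h2 := Finset.card_filter_le W (· < v)
    simp only [coe_range, Set.mem_Iio]
    omega
  · intro W hW W' hW' hh
    exact win_inj P t v W W' (hF W hW).1 (hF W' hW').1 (hF W hW).2 (hF W' hW').2 hh

lemma exists_init (t : ℕ) (X : Finset ℕ) : t ≤ X.card →
    ∃ W ⊆ X, W.card = t ∧ ∀ x ∈ X, ∀ w ∈ W, x ≤ w → x ∈ W := by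
  induction X using Finset.induction_on_max with
  | empty => intro h; exact ⟨∅, by simp, by simp at h ⊢; omega, by simp⟩
  | insert a s ha ih =>
    intro h
    have hn : a ∉ s := fun hh => lt_irrefl _ (ha a hh)
    rw [card_insert_of_notMem hn] at h
    rcases Nat.lt_or_ge s.card t with h1 | h1
    · exact ⟨insert a s, subset_rfl, by rw [card_insert_of_notMem hn]; omega,
        fun x hx _ _ _ => hx⟩
    · obtain ⟨W, hW, hc, hh⟩ := ih h1
      refine ⟨W, hW.trans (subset_insert _ _), hc, ?_⟩
      intro x hx w hw hxw
      rcases mem_insert.1 hx with rfl | hx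
      · have := ha w (hW hw); omega
      · exact hh x hx w hw hxw

lemma many_windows (t : ℕ) (ht : 1 ≤ t) (K : Finset ℕ) (F : Finset (Finset ℕ))
    (hF : ∀ W ⊆ K, Win (· ∈ K) t W → W ∈ F) : K.card ≤ F.card + t := by
  classical
  set Gd := K.filter (fun b => t ≤ (K.filter (b ≤ ·)).card) with hGd
  set Bd := K.filter (fun b => ¬ t ≤ (K.filter (b ≤ ·)).card) with hBd
  have hs : Gd.card + Bd.card = K.card := Finset.card_filter_add_card_filter_not _
  have hB : Bd.card ≤ t := by
    rcases Bd.eq_empty_or_nonempty with h | h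
    · simp [h]
    · have hm := Bd.min'_mem h
      have h1 : Bd ⊆ K.filter (Bd.min' h ≤ ·) := by
        intro x hx
        exact mem_filter.2 ⟨(mem_filter.1 hx).1, Bd.min'_le x hx⟩
      have := card_le_card h1
      have := (mem_filter.1 hm).2
      omega
  have hex : ∀ b ∈ Gd, ∃ W ∈ F, b ∈ W ∧ ∀ w ∈ W, b ≤ w := by
    intro b hb
    obtain ⟨hbK, hb⟩ := mem_filter.1 hb
    obtain ⟨W, hW, hc, hi⟩ := exists_init t _ hb
    have hge : ∀ w ∈ W, b ≤ w := fun w hw => (mem_filter.1 (hW hw)).2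
    have hK : ∀ w ∈ W, w ∈ K := fun w hw => (mem_filter.1 (hW hw)).1
    refine ⟨W, hF W hK ⟨hc, hK, ?_⟩, ?_, hge⟩
    · intro x hx w₁ h1 w₂ h2 h3 h4
      exact hi x (mem_filter.2 ⟨hx, (hge w₁ h1).trans h3⟩) w₂ h2 h4
    · have : W.Nonempty := card_pos.1 (by omega)
      obtain ⟨w, hw⟩ := this
      exact hi b (mem_filter.2 ⟨hbK, le_rfl⟩) w hw (hge w hw)
  choose! g hg using hex
  have : Gd.card ≤ F.card := by
    apply Finset.card_le_card_of_injOn g (fun b hb => (hg b hb).1)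
    intro x hx y hy hxy
    have h1 := hg x hx
    have h2 := hg y hy
    rw [hxy] at h1
    exact le_antisymm (h1.2.2 y h2.2.1) (h2.2.2 x h1.2.1)
  omega

/-- starting at height `a` -/
def st (E : Finset (ℕ × ℕ)) (v a : ℕ) : Prop := act E a v ∧ ∀ a' < a, ¬ act E a' v
/-- ended at height `a` -/
def en (E : Finset (ℕ × ℕ)) (v a : ℕ) : Prop := ¬ act E a v ∧ ∃ c, a = c + 1 ∧ act E c v

lemma act_mid {E : Finset (ℕ × ℕ)} {v a b c : ℕ} (h1 : act E a v) (h2 : act E c v) (hab : a ≤ b)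
    (hbc : b ≤ c) : act E b v := by
  obtain ⟨⟨x, hx, hx'⟩, _⟩ := h1
  obtain ⟨_, ⟨y, hy, hy'⟩⟩ := h2
  exact ⟨⟨x, by omega, hx'⟩, ⟨y, by omega, hy'⟩⟩

lemma st_uniq {E : Finset (ℕ × ℕ)} {v a b : ℕ} (h1 : st E v a) (h2 : st E v b) : a = b := by
  rcases lt_trichotomy a b with h | h | h
  · exact absurd h1.1 (h2.2 a h)
  · exact h
  · exact absurd h2.1 (h1.2 b h)

lemma en_uniq {E : Finset (ℕ × ℕ)} {v a b : ℕ} (h1 : en E v a) (h2 : en E v b) : a = b := by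
  obtain ⟨h1, c, rfl, hc⟩ := h1
  obtain ⟨h2, d, rfl, hd⟩ := h2
  rcases lt_trichotomy c d with h | h | h
  · exact absurd (act_mid hc hd (by omega) (by omega)) h1
  · rw [h]
  · exact absurd (act_mid hd hc (by omega) (by omega)) h2

lemma exists_fun {R : ℕ → ℕ → Prop} (h : ∀ v a b, R v a → R v b → a = b) :
    ∃ f : ℕ → ℕ, ∀ v a, R v a → f v = a := by
  classical
  refine ⟨fun v => if h : ∃ a, R v a then h.choose else 0, fun v a hva => ?_⟩
  have hx : ∃ a, R v a := ⟨a, hva⟩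
  simp only [dif_pos hx]
  exact h v _ _ hx.choose_spec hva

lemma distinct_windows (E : Finset (ℕ × ℕ)) (n t : ℕ) (ht : 1 ≤ t) (hE : E ⊆ range n ×ˢ range n)
    (F : Finset (Finset ℕ)) (hF : ∀ W ∈ F, ∃ a, Win (act E a) t W) :
    F.card ≤ n * (2 * (t + 1)) := by
  classical
  obtain ⟨s, hs⟩ := exists_fun (R := st E) (fun v a b => st_uniq)
  obtain ⟨e, he⟩ := exists_fun (R := en E) (fun v a b => en_uniq)
  have hn : ∀ a v, act E a v → v < n := by
    rintro a v ⟨⟨x, _, hx⟩, _⟩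
    have := hE hx
    simp at this
    exact this.2
  let F₁ := fun v => F.filter (fun W => Win (act E (s v)) t W ∧ (∃ w ∈ W, w ≤ v) ∧ (∃ w ∈ W, v ≤ w))
  let F₂ := fun v => F.filter (fun W => Win (act E (e v)) t W ∧ (∃ w ∈ W, w ≤ v) ∧ (∃ w ∈ W, v ≤ w))
  have hsub : F ⊆ (range n).biUnion (fun v => F₁ v ∪ F₂ v) := by
    intro W hW
    have hx := hF W hW
    have h1 := Nat.find_spec hx
    have h2 := fun m => Nat.find_min hx (m := m)
    generalize Nat.find hx = a at h1 h2
    by_cases hst : ∃ v ∈ W, st E v a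
    · obtain ⟨v, hv, hst⟩ := hst
      refine mem_biUnion.2 ⟨v, mem_range.2 (hn _ _ hst.1), mem_union_left _ (mem_filter.2 ⟨hW, ?_⟩)⟩
      rw [hs v a hst]
      exact ⟨h1, ⟨v, hv, le_rfl⟩, ⟨v, hv, le_rfl⟩⟩
    · push Not at hst
      have hne : W.Nonempty := card_pos.1 (by rw [h1.1]; omega)
      have hprev : ∀ v ∈ W, ∃ a' < a, act E a' v := by
        intro v hv
        by_contra hcon
        push Not at hcon
        exact hst v hv ⟨h1.2.1 v hv, hcon⟩
      obtain ⟨v₀, hv₀⟩ := hne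
      obtain ⟨a₀, ha₀, _⟩ := hprev v₀ hv₀
      obtain ⟨c, rfl⟩ : ∃ c, a = c + 1 := ⟨a - 1, by omega⟩
      have hact : ∀ v ∈ W, act E c v := by
        intro v hv
        obtain ⟨a', ha', h⟩ := hprev v hv
        exact act_mid h (h1.2.1 v hv) (by omega) (by omega)
      have hnw := h2 c (by omega)
      have : ∃ x, act E c x ∧ (∃ w ∈ W, w ≤ x) ∧ (∃ w ∈ W, x ≤ w) ∧ x ∉ W := by
        by_contra hcon
        push Not at hcon
        exact hnw ⟨h1.1, hact, fun x hx w₁ hw₁ w₂ hw₂ h3 h4 =>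
          hcon x hx ⟨w₁, hw₁, h3⟩ ⟨w₂, hw₂, h4⟩⟩
      obtain ⟨x, hx, ⟨w₁, hw₁, h3⟩, ⟨w₂, hw₂, h4⟩, hxW⟩ := this
      have hen : en E x (c + 1) :=
        ⟨fun hh => hxW (h1.2.2 x hh w₁ hw₁ w₂ hw₂ h3 h4), c, rfl, hx⟩
      refine mem_biUnion.2 ⟨x, mem_range.2 (hn _ _ hx), mem_union_right _ (mem_filter.2 ⟨hW, ?_⟩)⟩
      rw [he x _ hen]
      exact ⟨h1, ⟨w₁, hw₁, h3⟩, ⟨w₂, hw₂, h4⟩⟩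
  refine (card_le_card hsub).trans ?_
  have := Finset.card_biUnion_le_card_mul (range n) (fun v => F₁ v ∪ F₂ v) (2 * (t + 1)) ?_
  · simpa using this
  · intro v _
    have h1 : (F₁ v).card ≤ t + 1 := win_card (act E (s v)) t v _ (fun W hW => (mem_filter.1 hW).2)
    have h2 : (F₂ v).card ≤ t + 1 := win_card (act E (e v)) t v _ (fun W hW => (mem_filter.1 hW).2)
    have := card_union_le (F₁ v) (F₂ v)
    omega

lemma main (E : Finset (ℕ × ℕ)) (n t : ℕ) (ht : 1 ≤ t) (hE : E ⊆ range n ×ˢ range n)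
    (hno : ¬ ∃ S T : Finset ℕ, S.card = t ∧ T.card = t ∧ ∀ a ∈ S, ∀ b ∈ T,
      act E a b ∧ rowAct E a b) :
    E.card ≤ (t + t * (2 * (t + 1))) * n := by
  classical
  let K := fun a => (range n).filter (fun b => act E a b ∧ rowAct E a b)
  let RW := fun a => (K a).powerset.filter (fun W => Win (act E a) t W)
  have h1 : ∀ a, (K a).card ≤ (RW a).card + t := by
    intro a
    apply many_windows t ht
    rintro W hW ⟨hc, _, hcv⟩
    refine mem_filter.2 ⟨mem_powerset.2 hW, hc, fun w hw => (mem_filter.1 (hW hw)).2.1, ?_⟩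
    intro x hx w₁ hw₁ w₂ hw₂ h3 h4
    refine hcv x ?_ w₁ hw₁ w₂ hw₂ h3 h4
    obtain ⟨_, _, ⟨b₁, hb₁, hb₁'⟩, _⟩ := mem_filter.1 (hW hw₁)
    obtain ⟨hr, _, _, ⟨b₂, hb₂, hb₂'⟩⟩ := mem_filter.1 (hW hw₂)
    rw [mem_range] at hr
    exact mem_filter.2 ⟨mem_range.2 (by omega), hx, ⟨b₁, by omega, hb₁'⟩, ⟨b₂, by omega, hb₂'⟩⟩
  have h2 : E.card ≤ ∑ a ∈ range n, (K a).card := by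
    rw [← card_sigma]
    apply Finset.card_le_card_of_injOn (fun p : ℕ × ℕ => (⟨p.1, p.2⟩ : Σ _ : ℕ, ℕ))
    · rintro ⟨a, b⟩ hp
      have hp : (a, b) ∈ E := hp
      have := hE hp
      simp only [mem_product] at this
      have hm : (⟨a, b⟩ : Σ _ : ℕ, ℕ) ∈ (range n).sigma K := mem_sigma.2 ⟨this.1, mem_filter.2 ⟨this.2,
        ⟨⟨a, le_rfl, hp⟩, ⟨a, le_rfl, hp⟩⟩, ⟨⟨b, le_rfl, hp⟩, ⟨b, le_rfl, hp⟩⟩⟩⟩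
      exact hm
    · rintro ⟨a, b⟩ _ ⟨c, d⟩ _ h
      simpa using h
  set F := (range n).biUnion RW with hFdef
  have h3 : F.card ≤ n * (2 * (t + 1)) := by
    apply distinct_windows E n t ht hE
    intro W hW
    obtain ⟨a, _, ha⟩ := mem_biUnion.1 hW
    exact ⟨a, (mem_filter.1 ha).2⟩
  have h4 : ∑ a ∈ range n, (RW a).card ≤ t * F.card := by
    rw [← card_sigma]
    refine Finset.card_le_mul_card_image_of_maps_to (f := fun p : Σ _ : ℕ, Finset ℕ => p.2) ?_ t ?_
    · rintro ⟨a, W⟩ h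
      obtain ⟨h, h'⟩ := mem_sigma.1 h
      exact mem_biUnion.2 ⟨a, h, h'⟩
    · intro W hW
      by_contra hcon
      push Not at hcon
      set Q := ((range n).sigma RW).filter (fun p : Σ _ : ℕ, Finset ℕ => p.2 = W) with hQ
      have hQm : ∀ p ∈ Q, W ∈ RW p.1 := by
        rintro ⟨a, W'⟩ hp
        obtain ⟨hp1, hp2⟩ := mem_filter.1 hp
        rw [← hp2]
        exact (mem_sigma.1 hp1).2
      have hci : (Q.image Sigma.fst).card = Q.card := by
        apply card_image_of_injOn
        rintro ⟨a, W₁⟩ ha ⟨b, W₂⟩ hb hab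
        have e1 := (mem_filter.1 ha).2
        have e2 := (mem_filter.1 hb).2
        simp only at e1 e2 hab
        rw [e1, e2, hab]
      obtain ⟨S, hS, hSc⟩ := exists_subset_card_eq (s := Q.image Sigma.fst) (n := t) (by omega)
      obtain ⟨a, _, ha⟩ := mem_biUnion.1 hW
      refine hno ⟨S, W, hSc, (mem_filter.1 ha).2.1, ?_⟩
      intro a ha b hb
      obtain ⟨p, hp, rfl⟩ := mem_image.1 (hS ha)
      exact (mem_filter.1 (mem_powerset.1 (mem_filter.1 (hQm p hp)).1 hb)).2
  have h5 : ∑ a ∈ range n, (K a).card ≤ ∑ a ∈ range n, (RW a).card + n * t := by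
    calc _ ≤ ∑ a ∈ range n, ((RW a).card + t) := sum_le_sum fun a _ => h1 a
      _ = _ := by simp [sum_add_distrib]
  calc E.card ≤ t * F.card + n * t := by omega
    _ ≤ t * (n * (2 * (t + 1))) + n * t := by gcongr
    _ = _ := by ring

end DCB

/-- For every `t ≥ 1` there is a constant `C > 0` such that every cyclically-ordered
graph on `Fin n` which is bipartite with bipartition `A ∪ B`, where under some rotation
every element of `A` precedes every element of `B` and all edges join `A` to `B`, and
which has no two disjoint `t`-element vertex subsets with every two vertices from
different subsets forming a double cherry, has at most `C·n` edges. -/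
theorem double_cherry_cyclic_bipartite_ub :
    ∀ t : ℕ, 1 ≤ t → ∃ C : ℝ, 0 < C ∧
      ∀ (n : ℕ) (G : SimpleGraph (Fin n)) (A B : Finset (Fin n)),
        Disjoint A B → A ∪ B = Finset.univ →
        (∃ r : Fin n, ∀ a ∈ A, ∀ b ∈ B, a - r < b - r) →
        (∀ u v : Fin n, G.Adj u v → (u ∈ A ∧ v ∈ B) ∨ (u ∈ B ∧ v ∈ A)) →
        (¬ ∃ S T : Finset (Fin n), Disjoint S T ∧ S.card = t ∧ T.card = t ∧
            ∀ u ∈ S, ∀ v ∈ T, CyclicDoubleCherry G u v) →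
        (G.edgeSet.ncard : ℝ) ≤ C * n := by
  intro t ht
  refine ⟨((t + t * (2 * (t + 1)) : ℕ) : ℝ), by positivity, ?_⟩
  rintro n G A B hAB - ⟨r, hr⟩ hG hno
  classical
  have : NeZero n := ⟨by rintro rfl; exact r.elim0⟩
  set p : Fin n → ℕ := fun x => (x - r).val with hp
  have hpi : Function.Injective p := by
    intro x y h
    have : x - r = y - r := Fin.ext h
    simpa using this
  set D : Finset (Fin n × Fin n) := (A ×ˢ B).filter (fun q => G.Adj q.1 q.2) with hD
  set E : Finset (ℕ × ℕ) := D.image (Prod.map p p) with hEdef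
  have hmem : ∀ {a b}, (a, b) ∈ E → ∃ u ∈ A, ∃ v ∈ B, G.Adj u v ∧ p u = a ∧ p v = b := by
    intro a b h
    obtain ⟨⟨u, v⟩, huv, h⟩ := Finset.mem_image.1 h
    obtain ⟨h1, h2⟩ := Finset.mem_filter.1 huv
    obtain ⟨h3, h4⟩ := Finset.mem_product.1 h1
    simp only [Prod.map_apply, Prod.mk.injEq] at h
    exact ⟨u, h3, v, h4, h2, h.1, h.2⟩
  have hcard : G.edgeSet.ncard ≤ E.card := by
    rw [hEdef, Finset.card_image_of_injective _ (hpi.prodMap hpi)]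
    have hsub : G.edgeSet ⊆ ((D.image (fun q => s(q.1, q.2)) : Finset (Sym2 (Fin n))) : Set _) := by
      intro e
      induction e using Sym2.ind with
      | _ u v =>
        intro h
        have h : G.Adj u v := h
        rw [Finset.mem_coe, Finset.mem_image]
        rcases hG u v h with ⟨h1, h2⟩ | ⟨h1, h2⟩
        · exact ⟨(u, v), Finset.mem_filter.2 ⟨Finset.mem_product.2 ⟨h1, h2⟩, h⟩, rfl⟩
        · exact ⟨(v, u), Finset.mem_filter.2 ⟨Finset.mem_product.2 ⟨h2, h1⟩, h.symm⟩, Sym2.eq_swap⟩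
    refine (Set.ncard_le_ncard hsub (Finset.finite_toSet _)).trans ?_
    rw [Set.ncard_coe_finset]
    exact Finset.card_image_le
  have hER : E ⊆ Finset.range n ×ˢ Finset.range n := by
    rintro ⟨a, b⟩ h
    obtain ⟨u, _, v, _, _, rfl, rfl⟩ := hmem h
    simp [hp]
  have key := DCB.main E n t ht hER ?_
  · exact_mod_cast hcard.trans key
  rintro ⟨S, T, hS, hT, h⟩
  apply hno
  have hSne : S.Nonempty := Finset.card_pos.1 (by omega)
  have hTne : T.Nonempty := Finset.card_pos.1 (by omega)
  obtain ⟨a₀, ha₀⟩ := hSne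
  obtain ⟨b₀, hb₀⟩ := hTne
  have hSA : ∀ a ∈ S, ∃ u ∈ A, p u = a := by
    intro a ha
    obtain ⟨_, ⟨b₁, _, h1⟩, _⟩ := h a ha b₀ hb₀
    obtain ⟨u, hu, _, _, _, h2, _⟩ := hmem h1
    exact ⟨u, hu, h2⟩
  have hTB : ∀ b ∈ T, ∃ v ∈ B, p v = b := by
    intro b hb
    obtain ⟨⟨⟨a₁, _, h1⟩, _⟩, _⟩ := h a₀ ha₀ b hb
    obtain ⟨_, _, v, hv, _, _, h2⟩ := hmem h1
    exact ⟨v, hv, h2⟩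
  have hS' : (A.filter (fun u => p u ∈ S)).card = t := by
    rw [← hS, ← Finset.card_image_of_injective _ hpi]
    congr 1
    ext a
    simp only [Finset.mem_image, Finset.mem_filter]
    constructor
    · rintro ⟨u, ⟨_, h1⟩, rfl⟩; exact h1
    · intro ha
      obtain ⟨u, hu, rfl⟩ := hSA a ha
      exact ⟨u, ⟨hu, ha⟩, rfl⟩
  have hT' : (B.filter (fun u => p u ∈ T)).card = t := by
    rw [← hT, ← Finset.card_image_of_injective _ hpi]
    congr 1
    ext a
    simp only [Finset.mem_image, Finset.mem_filter]
    constructor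
    · rintro ⟨u, ⟨_, h1⟩, rfl⟩; exact h1
    · intro ha
      obtain ⟨u, hu, rfl⟩ := hTB a ha
      exact ⟨u, ⟨hu, ha⟩, rfl⟩
  refine ⟨_, _, Finset.disjoint_filter_filter hAB, hS', hT', ?_⟩
  intro u hu v hv
  obtain ⟨huA, hu⟩ := Finset.mem_filter.1 hu
  obtain ⟨hvB, hv⟩ := Finset.mem_filter.1 hv
  obtain ⟨⟨⟨a₁, la₁, h1⟩, ⟨a₂, la₂, h2⟩⟩, ⟨⟨b₁, lb₁, h3⟩, ⟨b₂, lb₂, h4⟩⟩⟩ := h _ hu _ hv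
  obtain ⟨u₁, hu₁, x₁, _, e1, rfl, f1⟩ := hmem h1
  obtain ⟨u₂, hu₂, x₂, _, e2, rfl, f2⟩ := hmem h2
  obtain ⟨x₃, _, v₁, hv₁, e3, f3, rfl⟩ := hmem h3
  obtain ⟨x₄, _, v₂, hv₂, e4, f4, rfl⟩ := hmem h4
  obtain rfl := hpi f1
  obtain rfl := hpi f2
  obtain rfl := hpi f3
  obtain rfl := hpi f4
  by_cases hadj : G.Adj x₄ x₂
  · exact Or.inl hadj
  have n1 : p u₁ ≠ p x₄ := fun hh => hadj (hpi hh ▸ e1)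
  have n2 : p u₂ ≠ p x₄ := fun hh => hadj (hpi hh ▸ e2)
  have n3 : p v₁ ≠ p x₂ := fun hh => hadj (hpi hh ▸ e3)
  have n4 : p v₂ ≠ p x₂ := fun hh => hadj (hpi hh ▸ e4)
  have l1 : u₁ - r < x₄ - r := lt_of_le_of_ne la₁ (fun hh => n1 (congrArg Fin.val hh))
  have l2 : x₄ - r < u₂ - r := lt_of_le_of_ne la₂ (fun hh => n2 (congrArg Fin.val hh).symm)
  have l3 : v₁ - r < x₂ - r := lt_of_le_of_ne lb₁ (fun hh => n3 (congrArg Fin.val hh))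
  have l4 : x₂ - r < v₂ - r := lt_of_le_of_ne lb₂ (fun hh => n4 (congrArg Fin.val hh).symm)
  have l5 := hr u₂ hu₂ v₁ hv₁
  refine Or.inr ⟨u₁, u₂, v₁, v₂, ⟨r, ?_⟩, e3, e4, e1.symm, e2.symm⟩
  show List.IsChain _ _
  simp [l1, l2, l3, l4, l5]
end
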